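/- Let d ≥ 1, k ≥ 1 be fixed integers, s ∈ (0,2] and L > 0. There exists a constant C depending only on s, L, k and d such that for every n > k and every probability density f in the Hölder ball H^s_d(L;[0,1]^d), if X_1,…,X_n are i.i.d. samples from f, then the bias of the Kozachenko–Leonenko estimator satisfies |E[ĥ_{n,k}(X)] − h(f)| ≤ C n^{−s/(s+d)} ln(n+1). -/

import Mathlib

open MeasureTheory Real

noncomputable section

abbrev Euc (d : ℕ) : Type := EuclideanSpace ℝ (Fin d)

/-- The unit cube `[0,1]^d`. -/
def unitCube (d : ℕ) : Set (Euc d) := {x | ∀ i, x i ∈ Set.Icc (0:ℝ) 1}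

/-- Volume of the unit Euclidean ball in `ℝ^d`. -/
def unitBallVol (d : ℕ) : ℝ := Real.pi ^ ((d : ℝ) / 2) / Real.Gamma (1 + (d : ℝ) / 2)

/-- The point of `ℝ^d` with integer coordinates `m`. -/
def intVec (d : ℕ) (m : Fin d → ℤ) : Euc d :=
  (WithLp.equiv 2 (Fin d → ℝ)).symm fun i => (m i : ℝ)

/-- Torus distance: `d(x,y) = min_{m ∈ ℤ^d} ‖x + m - y‖`. -/
def torusDist (d : ℕ) (x y : Euc d) : ℝ :=
  ⨅ m : Fin d → ℤ, ‖x + intVec d m - y‖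

/-- `(s,L)`-Hölder condition for `s ∈ (0,2]`. -/
def IsHolderOrder (d : ℕ) (s L : ℝ) (f : Euc d → ℝ) : Prop :=
  if s ≤ 1 then
    ∀ x y : Euc d, |f x - f y| ≤ L * ‖x - y‖ ^ s
  else
    ContDiff ℝ 1 f ∧ ∀ x y : Euc d, ‖gradient f x - gradient f y‖ ≤ L * ‖x - y‖ ^ (s - 1)

/-- `f` is 1-periodic in each coordinate. -/
def IsPeriodic (d : ℕ) (f : Euc d → ℝ) : Prop :=
  ∀ (x : Euc d) (i : Fin d), f (x + EuclideanSpace.single i 1) = f x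

/-- Probability density in the Hölder ball `H^s_d(L;[0,1]^d)`, represented by its
1-periodic extension to `ℝ^d`. -/
def HolderDensity (d : ℕ) (s L : ℝ) (f : Euc d → ℝ) : Prop :=
  IsHolderOrder d s L f ∧ IsPeriodic d f ∧ (∀ x, 0 ≤ f x) ∧
    (∫ x in unitCube d, f x) = 1

/-- The probability measure on `[0,1]^d` with density `f`. -/
def densityMeasure (d : ℕ) (f : Euc d → ℝ) : Measure (Euc d) :=
  (volume.restrict (unitCube d)).withDensity fun x => ENNReal.ofReal (f x)

/-- Law of `n` i.i.d. samples from density `f`. -/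
def sampleMeasure (d n : ℕ) (f : Euc d → ℝ) : Measure (Fin n → Euc d) :=
  Measure.pi fun _ => densityMeasure d f

/-- The `k`-th smallest element (1-indexed) of a multiset of reals. -/
def kthSmallest (s : Multiset ℝ) (k : ℕ) : ℝ :=
  (s.sort (· ≤ ·)).getD (k - 1) 0

/-- `R_{i,k}`: the `k`-nearest neighbor torus distance from `X i` to the other points. -/
def nnDist (d n : ℕ) (X : Fin n → Euc d) (i : Fin n) (k : ℕ) : ℝ :=
  kthSmallest ((Finset.univ.erase i).val.map fun j => torusDist d (X i) (X j)) k

/-- The digamma function: derivative of `ln Γ`. -/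
def digamma (x : ℝ) : ℝ := deriv (fun y => Real.log (Real.Gamma y)) x

/-- The Kozachenko–Leonenko `k`-nearest neighbor differential entropy estimator. -/
def klEstimator (d k n : ℕ) (X : Fin n → Euc d) : ℝ :=
  Real.log k - digamma k +
    (1 / n : ℝ) * ∑ i : Fin n, Real.log ((n / k : ℝ) * (unitBallVol d * nnDist d n X i k ^ d))

/-- Differential entropy `h(f) = -∫_{[0,1]^d} f ln f`. -/
def diffEntropy (d : ℕ) (f : Euc d → ℝ) : ℝ :=
  -∫ x in unitCube d, f x * Real.log (f x)

end

section
/-! ### The `k`-th smallest element -/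

theorem List.getElem_le_iff_lt_countP {l : List ℝ} (hl : l.Pairwise (· ≤ ·)) (t : ℝ) (i : ℕ)
    (hi : i < l.length) : l[i] ≤ t ↔ i < l.countP (· ≤ t) := by
  induction l generalizing i with
  | nil => simp at hi
  | cons a l ih =>
    rw [List.pairwise_cons] at hl
    cases i with
    | zero =>
      simp only [List.getElem_cons_zero, List.countP_pos_iff, List.mem_cons, decide_eq_true_eq]
      refine ⟨fun h => ⟨a, Or.inl rfl, h⟩, ?_⟩
      rintro ⟨b, rfl | hb, h⟩
      · exact h
      · exact (hl.1 b hb).trans h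
    | succ i =>
      have hi' : i < l.length := by simpa using hi
      rw [List.getElem_cons_succ, ih hl.2 i hi', List.countP_cons]
      by_cases ha : a ≤ t
      · simp [ha]
      · have : l.countP (· ≤ t) = 0 := by
          rw [List.countP_eq_zero]
          intro b hb
          simpa using lt_of_lt_of_le (not_le.1 ha) (hl.1 b hb)
        simp [ha, this]

theorem kthSmallest_eq_getElem {s : Multiset ℝ} {k : ℕ} (hk : 1 ≤ k) (hks : k ≤ s.card) :
    kthSmallest s k = (s.sort (· ≤ ·))[k - 1]'(by rw [Multiset.length_sort]; omega) := by
  rw [kthSmallest, List.getD_eq_getElem]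

theorem kthSmallest_mem {s : Multiset ℝ} {k : ℕ} (hk : 1 ≤ k) (hks : k ≤ s.card) :
    kthSmallest s k ∈ s := by
  rw [kthSmallest_eq_getElem hk hks, ← Multiset.mem_sort (r := (· ≤ ·))]
  exact List.getElem_mem _

theorem kthSmallest_le_iff {s : Multiset ℝ} {k : ℕ} (hk : 1 ≤ k) (hks : k ≤ s.card) (t : ℝ) :
    kthSmallest s k ≤ t ↔ k ≤ s.countP (· ≤ t) := by
  rw [kthSmallest_eq_getElem hk hks,
    List.getElem_le_iff_lt_countP (Multiset.pairwise_sort s (· ≤ ·))]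
  conv_rhs => rw [← Multiset.sort_eq s (· ≤ ·), Multiset.coe_countP]
  omega

/-- The `k`-th smallest coordinate of a real vector. -/
noncomputable def orderStat {m : ℕ} (k : ℕ) (D : Fin m → ℝ) : ℝ :=
  kthSmallest (Finset.univ.val.map D) k

variable {m k : ℕ}

theorem exists_orderStat_eq (hk : 1 ≤ k) (hkm : k ≤ m) (D : Fin m → ℝ) :
    ∃ j, orderStat k D = D j := by
  have := kthSmallest_mem (s := Finset.univ.val.map D) hk (by simpa using hkm)
  obtain ⟨j, -, hj⟩ := Multiset.mem_map.1 this
  exact ⟨j, hj.symm⟩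

theorem orderStat_le_iff (hk : 1 ≤ k) (hkm : k ≤ m) (D : Fin m → ℝ) (t : ℝ) :
    orderStat k D ≤ t ↔ k ≤ (Finset.univ.filter fun j => D j ≤ t).card := by
  rw [orderStat, kthSmallest_le_iff hk (by simpa using hkm), Multiset.countP_map]
  rfl

theorem setOf_filter_eq_pi (A : Set ℝ) [DecidablePred (· ∈ A)] (S : Finset (Fin m)) :
    {D : Fin m → ℝ | (Finset.univ.filter fun j => D j ∈ A) = S} =
      Set.univ.pi fun j => if j ∈ S then A else Aᶜ := by
  ext D
  simp only [Set.mem_ofPred_eq, Set.mem_univ_pi, Finset.ext_iff, Finset.mem_filter,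
    Finset.mem_univ, true_and]
  refine forall_congr' fun j => ?_
  by_cases hj : j ∈ S <;> simp [hj]

theorem setOf_le_card_filter_eq_biUnion (A : Set ℝ) [DecidablePred (· ∈ A)] :
    {D : Fin m → ℝ | k ≤ (Finset.univ.filter fun j => D j ∈ A).card} =
      ⋃ S ∈ (Finset.univ.filter fun S : Finset (Fin m) => k ≤ S.card),
        {D : Fin m → ℝ | (Finset.univ.filter fun j => D j ∈ A) = S} := by
  ext D; simp

theorem measurable_orderStat (hk : 1 ≤ k) (hkm : k ≤ m) :
    Measurable (orderStat k : (Fin m → ℝ) → ℝ) := by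
  classical
  refine measurable_of_Iic fun t => ?_
  have : orderStat k ⁻¹' Set.Iic t =
      {D : Fin m → ℝ | k ≤ (Finset.univ.filter fun j => D j ∈ Set.Iic t).card} := by
    ext D
    simp only [Set.mem_preimage, Set.mem_Iic, Set.mem_ofPred_eq, orderStat_le_iff hk hkm]
  rw [this, setOf_le_card_filter_eq_biUnion (Set.Iic t)]
  refine Finset.measurableSet_biUnion _ fun S _ => ?_
  rw [setOf_filter_eq_pi (Set.Iic t) S]
  refine MeasurableSet.univ_pi fun j => ?_
  split_ifs
  exacts [measurableSet_Iic, measurableSet_Iic.compl]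

/-- Upper tail of the binomial distribution. -/
noncomputable def binomTail (m k : ℕ) (p : ℝ) : ℝ :=
  ∑ j ∈ Finset.Icc k m, (m.choose j : ℝ) * p ^ j * (1 - p) ^ (m - j)

theorem measureReal_le_card_filter (ν : Measure ℝ) [IsProbabilityMeasure ν] {A : Set ℝ}
    [DecidablePred (· ∈ A)]    (hA : MeasurableSet A) :
    (Measure.pi fun _ : Fin m => ν).real {D | k ≤ (Finset.univ.filter fun j => D j ∈ A).card} =
      binomTail m k (ν.real A) := by
  have hmeas : ∀ S : Finset (Fin m),
      MeasurableSet {D : Fin m → ℝ | (Finset.univ.filter fun j => D j ∈ A) = S} := by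
    intro S
    rw [setOf_filter_eq_pi _ S]
    refine MeasurableSet.univ_pi fun j => ?_
    split_ifs
    exacts [hA, hA.compl]
  have hS : ∀ S : Finset (Fin m), (Measure.pi fun _ : Fin m => ν).real
      {D | (Finset.univ.filter fun j => D j ∈ A) = S} =
      ν.real A ^ S.card * (1 - ν.real A) ^ (m - S.card) := by
    intro S
    rw [setOf_filter_eq_pi, measureReal_def, Measure.pi_pi, ENNReal.toReal_prod]
    have : ∀ j : Fin m, (ν (if j ∈ S then A else Aᶜ)).toReal =
        if j ∈ S then ν.real A else 1 - ν.real A := by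
      intro j
      split_ifs
      · rfl
      · rw [← measureReal_def, probReal_compl_eq_one_sub hA]
    simp_rw [this]
    rw [Finset.prod_ite]
    simp [Finset.filter_not, Finset.card_sdiff]
  rw [setOf_le_card_filter_eq_biUnion, measureReal_biUnion_finset]
  · simp_rw [hS]
    rw [binomTail, Finset.sum_filter]
    have := Finset.sum_powerset_apply_card
      (fun j => if k ≤ j then ν.real A ^ j * (1 - ν.real A) ^ (m - j) else 0)
      (x := (Finset.univ : Finset (Fin m)))
    rw [Finset.powerset_univ] at this
    rw [this, ← Finset.sum_subset (s₁ := Finset.Icc k m)]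
    · refine Finset.sum_congr (by simp) fun j hj => ?_
      rw [if_pos (Finset.mem_Icc.1 hj).1]
      simp [mul_assoc]
    · intro j; simp
    · intro j hj hj'
      have : ¬ k ≤ j := by simp at hj hj'; omega
      simp [this]
  · intro S _ T _ hST
    exact Set.disjoint_left.2 fun D h1 h2 => hST (h1.symm.trans h2)
  · exact fun S _ => hmeas S

end

section
/-! ### Integrals of binomial tails -/

theorem integral_bernstein {m j : ℕ} (hj : j ≤ m) :
    ∫ u in (0 : ℝ)..1, (m.choose j : ℝ) * u ^ j * (1 - u) ^ (m - j) = 1 / (m + 1) := by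
  have heval : ∀ j u, (bernsteinPolynomial ℝ m j).eval u =
      (m.choose j : ℝ) * u ^ j * (1 - u) ^ (m - j) := by
    intro j u; simp [bernsteinPolynomial]
  simp_rw [← heval]
  induction j with
  | zero =>
    have h : ∀ u ∈ Set.uIcc (0 : ℝ) 1, HasDerivAt
        (fun u => -((bernsteinPolynomial ℝ (m + 1) 0).eval u) / (m + 1))
        ((bernsteinPolynomial ℝ m 0).eval u) u := by
      intro u _
      have := ((bernsteinPolynomial ℝ (m + 1) 0).hasDerivAt u).neg.div_const ((m : ℝ) + 1)
      rw [bernsteinPolynomial.derivative_zero] at this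
      convert! this using 1
      have : (m : ℝ) + 1 ≠ 0 := by positivity
      simp
      field_simp
      ring
    rw [intervalIntegral.integral_eq_sub_of_hasDerivAt h
      ((Polynomial.continuous _).intervalIntegrable _ _)]
    simp [bernsteinPolynomial.eval_at_0, bernsteinPolynomial.eval_at_1]
    ring
  | succ j ih =>
    rw [← ih (by omega)]
    have h : ∀ u ∈ Set.uIcc (0 : ℝ) 1, HasDerivAt
        (fun u => (bernsteinPolynomial ℝ (m + 1) (j + 1)).eval u / (m + 1))
        ((bernsteinPolynomial ℝ m j).eval u - (bernsteinPolynomial ℝ m (j + 1)).eval u) u := by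
      intro u _
      have := ((bernsteinPolynomial ℝ (m + 1) (j + 1)).hasDerivAt u).div_const ((m : ℝ) + 1)
      rw [bernsteinPolynomial.derivative_succ] at this
      convert! this using 1
      have : (m : ℝ) + 1 ≠ 0 := by positivity
      simp
      field_simp
    have h2 := intervalIntegral.integral_eq_sub_of_hasDerivAt h
      (((Polynomial.continuous _).sub (Polynomial.continuous _)).intervalIntegrable _ _)
    rw [intervalIntegral.integral_sub ((Polynomial.continuous _).intervalIntegrable _ _)
      ((Polynomial.continuous _).intervalIntegrable _ _)] at h2
    rw [bernsteinPolynomial.eval_at_0, bernsteinPolynomial.eval_at_1] at h2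
    have h3 : j ≠ m := by omega
    simp [h3] at h2
    linarith

theorem lintegral_Ioo_ofReal_eq {g : ℝ → ℝ} (hg : Continuous g)
    (hg0 : ∀ u ∈ Set.Ioo (0 : ℝ) 1, 0 ≤ g u) :
    ∫⁻ u in Set.Ioo (0 : ℝ) 1, ENNReal.ofReal (g u) = ENNReal.ofReal (∫ u in (0 : ℝ)..1, g u) := by
  rw [intervalIntegral.integral_of_le zero_le_one, integral_Ioc_eq_integral_Ioo,
    ofReal_integral_eq_lintegral_ofReal]
  · exact (hg.integrableOn_Icc (a := 0) (b := 1)).mono_set Set.Ioo_subset_Icc_self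
  · exact (ae_restrict_iff' measurableSet_Ioo).2 (ae_of_all _ hg0)

variable {m k : ℕ}

theorem binomTail_nonneg {u : ℝ} (hu : u ∈ Set.Icc (0 : ℝ) 1) : 0 ≤ binomTail m k u := by
  have h1 := hu.1
  have h2 : 0 ≤ 1 - u := by linarith [hu.2]
  exact Finset.sum_nonneg fun j _ => by positivity

theorem one_sub_binomTail (hkm : k ≤ m) (u : ℝ) :
    1 - binomTail m k u = ∑ j ∈ Finset.range k, (m.choose j : ℝ) * u ^ j * (1 - u) ^ (m - j) := by
  have h := add_pow u (1 - u) m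
  rw [show u + (1 - u) = 1 by ring, one_pow, ← Finset.sum_range_add_sum_Ico _
    (show k ≤ m + 1 by omega)] at h
  have h2 : Finset.Ico k (m + 1) = Finset.Icc k m := by ext; simp
  rw [h2] at h
  have h3 : ∀ j, u ^ j * (1 - u) ^ (m - j) * (m.choose j : ℝ) =
    (m.choose j : ℝ) * u ^ j * (1 - u) ^ (m - j) := fun j => by ring
  simp_rw [h3] at h
  rw [binomTail]
  linarith

theorem lintegral_binomTail_mul_inv (hk : 1 ≤ k) :
    ∫⁻ u in Set.Ioo (0 : ℝ) 1, ENNReal.ofReal (binomTail m k u) * ENNReal.ofReal u⁻¹ =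
      ENNReal.ofReal (∑ j ∈ Finset.Icc k m, (1 : ℝ) / j) := by
  set g : ℝ → ℝ := fun u => ∑ j ∈ Finset.Icc k m,
    (m : ℝ) / j * (((m - 1).choose (j - 1) : ℝ) * u ^ (j - 1) * (1 - u) ^ (m - 1 - (j - 1))) with hg
  have hgb : ∀ u ∈ Set.Ioo (0 : ℝ) 1, binomTail m k u * u⁻¹ = g u := by
    intro u hu
    rw [binomTail, Finset.sum_mul]
    refine Finset.sum_congr rfl fun j hj => ?_
    obtain ⟨hj1, hj2⟩ := Finset.mem_Icc.1 hj
    obtain ⟨i, rfl⟩ : ∃ i, j = i + 1 := ⟨j - 1, by omega⟩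
    obtain ⟨l, rfl⟩ : ∃ l, m = l + 1 := ⟨m - 1, by omega⟩
    have hu0 : u ≠ 0 := hu.1.ne'
    have hc : ((l : ℝ) + 1) * (l.choose i) = ((l + 1).choose (i + 1)) * ((i : ℝ) + 1) := by
      exact_mod_cast Nat.add_one_mul_choose_eq l i
    have hi : (i : ℝ) + 1 ≠ 0 := by positivity
    simp only [Nat.add_sub_cancel, Nat.add_sub_add_right, Nat.cast_add, Nat.cast_one]
    rw [pow_succ]
    field_simp
    linear_combination -(1 - u) ^ (l - i) * hc
  have hgc : Continuous g := by fun_prop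
  have h1 : ∀ u ∈ Set.Ioo (0 : ℝ) 1,
      ENNReal.ofReal (binomTail m k u) * ENNReal.ofReal u⁻¹ = ENNReal.ofReal (g u) := by
    intro u hu
    rw [← hgb u hu, ENNReal.ofReal_mul (binomTail_nonneg ⟨hu.1.le, hu.2.le⟩)]
  rw [setLIntegral_congr_fun measurableSet_Ioo h1, lintegral_Ioo_ofReal_eq hgc]
  · congr 1
    rw [hg, intervalIntegral.integral_finsetSum]
    · refine Finset.sum_congr rfl fun j hj => ?_
      obtain ⟨hj1, hj2⟩ := Finset.mem_Icc.1 hj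
      rw [intervalIntegral.integral_const_mul, integral_bernstein (by omega)]
      have : (m : ℝ) ≠ 0 := by norm_cast; omega
      rw [Nat.cast_sub (by omega)]
      simp
      field_simp
    · exact fun j _ => Continuous.intervalIntegrable (by fun_prop) _ _
  · intro u hu
    rw [← hgb u hu]
    exact mul_nonneg (binomTail_nonneg ⟨hu.1.le, hu.2.le⟩) (inv_nonneg.2 hu.1.le)

theorem lintegral_one_sub_binomTail_mul (hkm : k ≤ m) :
    ∫⁻ u in Set.Ioo (0 : ℝ) 1, ENNReal.ofReal (1 - binomTail m k u) * ENNReal.ofReal (2 * u) =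
      ENNReal.ofReal (k * (k + 1) / ((m + 1) * (m + 2))) := by
  set g : ℝ → ℝ := fun u => ∑ j ∈ Finset.range k,
    2 * ((j : ℝ) + 1) / (m + 1) *
      (((m + 1).choose (j + 1) : ℝ) * u ^ (j + 1) * (1 - u) ^ (m + 1 - (j + 1))) with hg
  have hgb : ∀ u, (1 - binomTail m k u) * (2 * u) = g u := by
    intro u
    rw [one_sub_binomTail hkm, Finset.sum_mul]
    refine Finset.sum_congr rfl fun j hj => ?_
    have hc : ((m : ℝ) + 1) * (m.choose j) = ((m + 1).choose (j + 1)) * ((j : ℝ) + 1) := by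
      exact_mod_cast Nat.add_one_mul_choose_eq m j
    have hi : (m : ℝ) + 1 ≠ 0 := by positivity
    rw [Nat.add_sub_add_right]
    field_simp
    rw [pow_succ]
    linear_combination u ^ j * u * (1 - u) ^ (m - j) * hc
  have hnn : ∀ u ∈ Set.Ioo (0 : ℝ) 1, 0 ≤ 1 - binomTail m k u := by
    intro u hu
    rw [one_sub_binomTail hkm]
    have h1 := hu.1.le
    have h2 : 0 ≤ 1 - u := by linarith [hu.2]
    exact Finset.sum_nonneg fun j _ => by positivity
  have hgc : Continuous g := by fun_prop
  have h1 : ∀ u ∈ Set.Ioo (0 : ℝ) 1,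
      ENNReal.ofReal (1 - binomTail m k u) * ENNReal.ofReal (2 * u) = ENNReal.ofReal (g u) := by
    intro u hu
    rw [← hgb u, ENNReal.ofReal_mul (hnn u hu)]
  rw [setLIntegral_congr_fun measurableSet_Ioo h1, lintegral_Ioo_ofReal_eq hgc]
  · congr 1
    rw [hg, intervalIntegral.integral_finsetSum]
    · have : ∀ j ∈ Finset.range k, ∫ u in (0:ℝ)..1, 2 * ((j : ℝ) + 1) / (m + 1) *
          (((m + 1).choose (j + 1) : ℝ) * u ^ (j + 1) * (1 - u) ^ (m + 1 - (j + 1))) =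
          2 * ((j : ℝ) + 1) / (m + 1) * (1 / ((m + 1 : ℕ) + 1)) := by
        intro j hj
        have := Finset.mem_range.1 hj
        rw [intervalIntegral.integral_const_mul, integral_bernstein (by omega)]
      rw [Finset.sum_congr rfl this, ← Finset.sum_mul, ← Finset.sum_div, ← Finset.mul_sum]
      have hs : ∑ j ∈ Finset.range k, ((j : ℝ) + 1) = k * (k + 1) / 2 := by
        clear * -
        induction k with
        | zero => simp
        | succ k ih => rw [Finset.sum_range_succ, ih]; push_cast; ring
      rw [hs]
      push_cast
      field_simp
      ring
    · exact fun j _ => Continuous.intervalIntegrable (by fun_prop) _ _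
  · intro u hu
    rw [← hgb u]
    exact mul_nonneg (hnn u hu) (by linarith [hu.1])

/-! ### The probability integral transform of an order statistic -/

open ProbabilityTheory

theorem continuous_cdf (ν : Measure ℝ) [IsProbabilityMeasure ν] [NullSingletonClass ν] :
    Continuous (cdf ν) := by
  refine continuous_iff_continuousAt.2 fun a => ?_
  rw [(monotone_cdf ν).continuousAt_iff_leftLim_eq_rightLim, StieltjesFunction.rightLim_eq]
  have h := (cdf ν).measure_singleton a
  rw [measure_cdf, measure_singleton] at h
  exact le_antisymm ((monotone_cdf ν).leftLim_le le_rfl)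
    (by linarith [ENNReal.ofReal_eq_zero.1 h.symm])

theorem exists_cdf_le_iff (ν : Measure ℝ) [IsProbabilityMeasure ν] [NullSingletonClass ν] {u : ℝ}
    (hu : u ∈ Set.Ioo (0 : ℝ) 1) : ∃ r, cdf ν r = u ∧ ∀ t, cdf ν t ≤ u ↔ t ≤ r := by
  have hc := continuous_cdf ν
  obtain ⟨b, hb⟩ := ((tendsto_cdf_atTop ν).eventually (lt_mem_nhds hu.2)).exists
  obtain ⟨a, ha⟩ := ((tendsto_cdf_atBot ν).eventually (gt_mem_nhds hu.1)).exists
  set S := {t | cdf ν t ≤ u}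
  have hbdd : BddAbove S := ⟨b, fun t ht => le_of_not_gt fun hbt =>
    absurd (((monotone_cdf ν) hbt.le).trans ht) (not_le.2 hb)⟩
  have hmem : sSup S ∈ S := (isClosed_le hc continuous_const).csSup_mem ⟨a, ha.le⟩ hbdd
  have hab : a ≤ b := le_of_not_gt fun h => by linarith [monotone_cdf ν h.le]
  obtain ⟨t, -, ht⟩ := intermediate_value_Icc hab hc.continuousOn ⟨ha.le, hb.le⟩
  refine ⟨sSup S, le_antisymm hmem ?_, fun t => ⟨fun h => le_csSup hbdd h, fun h => ?_⟩⟩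
  · rw [← ht]
    exact monotone_cdf ν (le_csSup hbdd ht.le)
  · exact ((monotone_cdf ν) h).trans hmem

variable (ν : Measure ℝ) [IsProbabilityMeasure ν] [NullSingletonClass ν]

theorem measureReal_cdf_orderStat_le (hk : 1 ≤ k) (hkm : k ≤ m) {u : ℝ}
    (hu : u ∈ Set.Ioo (0 : ℝ) 1) :
    (Measure.pi fun _ : Fin m => ν).real {D | cdf ν (orderStat k D) ≤ u} = binomTail m k u := by
  obtain ⟨r, hr, hiff⟩ := exists_cdf_le_iff ν hu
  simp_rw [hiff, orderStat_le_iff hk hkm]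
  have := measureReal_le_card_filter (m := m) (k := k) ν (measurableSet_Iic (a := r))
  rw [← cdf_eq_real, hr] at this
  exact this

theorem measurable_cdf_orderStat (hk : 1 ≤ k) (hkm : k ≤ m) :
    Measurable fun D : Fin m → ℝ => cdf ν (orderStat k D) :=
  (continuous_cdf ν).measurable.comp (measurable_orderStat hk hkm)

theorem ae_cdf_orderStat_pos (hk : 1 ≤ k) (hkm : k ≤ m) :
    ∀ᵐ D ∂(Measure.pi fun _ : Fin m => ν), 0 < cdf ν (orderStat k D) := by
  set P := Measure.pi fun _ : Fin m => ν
  have h0 : P.real {D | ¬ 0 < cdf ν (orderStat k D)} ≤ 0 := by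
    have hlim : Filter.Tendsto (binomTail m k) (nhdsWithin 0 (Set.Ioi 0)) (nhds 0) := by
      have hc : Continuous (binomTail m k) := by unfold binomTail; fun_prop
      have h00 : binomTail m k 0 = 0 := by
        refine Finset.sum_eq_zero fun j hj => ?_
        have : j ≠ 0 := by have := (Finset.mem_Icc.1 hj).1; omega
        simp [this]
      have := (hc.tendsto 0).mono_left (nhdsWithin_le_nhds (s := Set.Ioi 0))
      rwa [h00] at this
    refine ge_of_tendsto hlim ?_
    filter_upwards [Ioo_mem_nhdsGT (zero_lt_one' ℝ)] with u hu
    rw [← measureReal_cdf_orderStat_le ν hk hkm hu]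
    exact measureReal_mono fun D hD => (not_lt.1 hD).trans hu.1.le
  have := le_antisymm h0 measureReal_nonneg
  rwa [measureReal_eq_zero_iff] at this

theorem lintegral_lintegral_indicator_swap {Ω : Type*} [MeasurableSpace Ω] (P : Measure Ω)
    [SFinite P] {s : Set (Ω × ℝ)} (hs : MeasurableSet s) {g : ℝ → ENNReal} (hg : Measurable g)
    (I : Set ℝ) :
    ∫⁻ ω, (∫⁻ u in I, s.indicator (fun p => g p.2) (ω, u)) ∂P =
      ∫⁻ u in I, P {ω | (ω, u) ∈ s} * g u := by
  rw [lintegral_lintegral_swap]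
  · refine lintegral_congr fun u => ?_
    have : ∀ ω, s.indicator (fun p => g p.2) (ω, u) =
        {ω | (ω, u) ∈ s}.indicator (fun _ => g u) ω := fun ω => rfl
    simp_rw [this]
    have hu : MeasurableSet {ω | (ω, u) ∈ s} := measurable_prodMk_right hs
    rw [lintegral_indicator_const hu, mul_comm]
  · exact ((hg.comp measurable_snd).indicator hs).aemeasurable

theorem lintegral_Ioo_indicator_inv {v : ℝ} (hv : 0 < v) (hv1 : v ≤ 1) :
    ∫⁻ u in Set.Ioo (0 : ℝ) 1, {u | v ≤ u}.indicator (fun u => ENNReal.ofReal u⁻¹) u =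
      ENNReal.ofReal (-log v) := by
  have hm : MeasurableSet {u : ℝ | v ≤ u} := measurableSet_Ici
  rw [lintegral_indicator hm, Measure.restrict_restrict hm]
  have : {u | v ≤ u} ∩ Set.Ioo 0 1 = Set.Ico v 1 := by
    ext u
    simp only [Set.mem_inter_iff, Set.mem_ofPred_eq, Set.mem_Ioo, Set.mem_Ico]
    exact ⟨fun h => ⟨h.1, h.2.2⟩, fun h => ⟨h.1, hv.trans_le h.1, h.2⟩⟩
  rw [this, ← ofReal_integral_eq_lintegral_ofReal, integral_Ico_eq_integral_Ioc,
    ← intervalIntegral.integral_of_le hv1, integral_inv_of_pos hv one_pos, one_div, log_inv]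
  · have : ContinuousOn (fun u : ℝ => u⁻¹) (Set.Icc v 1) :=
      continuousOn_inv₀.mono fun u hu => (hv.trans_le hu.1).ne'
    exact this.integrableOn_Icc.mono_set Set.Ico_subset_Icc_self
  · exact (ae_restrict_iff' measurableSet_Ico).2
      (ae_of_all _ fun u hu => inv_nonneg.2 (hv.le.trans hu.1))

theorem lintegral_Ioo_indicator_two_mul {v : ℝ} (hv : 0 < v) (hv1 : v ≤ 1) :
    ∫⁻ u in Set.Ioo (0 : ℝ) 1, {u | u < v}.indicator (fun u => ENNReal.ofReal (2 * u)) u =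
      ENNReal.ofReal (v ^ 2) := by
  have hm : MeasurableSet {u : ℝ | u < v} := measurableSet_Iio
  rw [lintegral_indicator hm, Measure.restrict_restrict hm]
  have : {u | u < v} ∩ Set.Ioo 0 1 = Set.Ioo 0 v := by
    ext u
    simp only [Set.mem_inter_iff, Set.mem_ofPred_eq, Set.mem_Ioo]
    exact ⟨fun h => ⟨h.2.1, h.1⟩, fun h => ⟨h.2, h.1, h.2.trans_le hv1⟩⟩
  rw [this, ← ofReal_integral_eq_lintegral_ofReal, ← integral_Ioc_eq_integral_Ioo,
    ← intervalIntegral.integral_of_le hv.le]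
  · congr 1
    rw [intervalIntegral.integral_const_mul, integral_id]
    ring
  · exact (Continuous.integrableOn_Icc (by fun_prop)).mono_set Set.Ioo_subset_Icc_self
  · exact (ae_restrict_iff' measurableSet_Ioo).2
      (ae_of_all _ fun u hu => by have := hu.1; simp only [Pi.zero_apply]; positivity)

theorem lintegral_neg_log_cdf_orderStat (hk : 1 ≤ k) (hkm : k ≤ m) :
    ∫⁻ D, ENNReal.ofReal (-log (cdf ν (orderStat k D))) ∂(Measure.pi fun _ : Fin m => ν) =
      ENNReal.ofReal (∑ j ∈ Finset.Icc k m, (1 : ℝ) / j) := by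
  set P := Measure.pi fun _ : Fin m => ν
  have hU := measurable_cdf_orderStat ν hk hkm
  have hs : MeasurableSet {p : (Fin m → ℝ) × ℝ | cdf ν (orderStat k p.1) ≤ p.2} :=
    measurableSet_le (hU.comp measurable_fst) measurable_snd
  have h := lintegral_lintegral_indicator_swap P hs
    (g := fun u => ENNReal.ofReal u⁻¹) (by fun_prop) (Set.Ioo 0 1)
  rw [← lintegral_binomTail_mul_inv hk]
  refine Eq.trans (lintegral_congr_ae ?_) (h.trans (setLIntegral_congr_fun measurableSet_Ioo ?_))
  · filter_upwards [ae_cdf_orderStat_pos ν hk hkm] with D hD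
    exact (lintegral_Ioo_indicator_inv hD (cdf_le_one ν _)).symm
  · intro u hu
    simp only [Set.mem_ofPred_eq]
    rw [← measureReal_cdf_orderStat_le ν hk hkm hu, ofReal_measureReal]

theorem lintegral_sq_cdf_orderStat (hk : 1 ≤ k) (hkm : k ≤ m) :
    ∫⁻ D, ENNReal.ofReal (cdf ν (orderStat k D) ^ 2) ∂(Measure.pi fun _ : Fin m => ν) =
      ENNReal.ofReal (k * (k + 1) / ((m + 1) * (m + 2))) := by
  set P := Measure.pi fun _ : Fin m => ν
  have hU := measurable_cdf_orderStat ν hk hkm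
  have hs : MeasurableSet {p : (Fin m → ℝ) × ℝ | p.2 < cdf ν (orderStat k p.1)} :=
    measurableSet_lt measurable_snd (hU.comp measurable_fst)
  have h := lintegral_lintegral_indicator_swap P hs
    (g := fun u => ENNReal.ofReal (2 * u)) (by fun_prop) (Set.Ioo 0 1)
  rw [← lintegral_one_sub_binomTail_mul hkm]
  refine Eq.trans (lintegral_congr_ae ?_) (h.trans (setLIntegral_congr_fun measurableSet_Ioo ?_))
  · filter_upwards [ae_cdf_orderStat_pos ν hk hkm] with D hD
    exact (lintegral_Ioo_indicator_two_mul hD (cdf_le_one ν _)).symm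
  · intro u hu
    simp only [Set.mem_ofPred_eq]
    rw [← measureReal_cdf_orderStat_le ν hk hkm hu, ← probReal_compl_eq_one_sub
      (measurableSet_le hU measurable_const), ofReal_measureReal]
    congr 2
    ext D
    simp

end

section
open scoped Pointwise

/-! ### Torus geometry -/

variable {d : ℕ}

/-- The representative of `w` modulo `ℤ^d` with coordinates in `[-1/2, 1/2)`. -/
noncomputable def fracVec (w : Euc d) : Euc d :=
  WithLp.toLp 2 fun i => w i - round (w i)

theorem torusDist_eq_norm_fracVec (x y : Euc d) : torusDist d x y = ‖fracVec (y - x)‖ := by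
  refine le_antisymm ?_ (le_ciInf fun m => ?_)
  · refine (ciInf_le ⟨0, ?_⟩ fun i => round ((y - x) i)).trans (le_of_eq ?_)
    · rintro _ ⟨m, rfl⟩
      exact norm_nonneg _
    · rw [← norm_neg]
      congr 1
      ext i
      simp [fracVec, intVec]
      ring
  · rw [EuclideanSpace.norm_eq, EuclideanSpace.norm_eq]
    refine Real.sqrt_le_sqrt (Finset.sum_le_sum fun i _ => ?_)
    refine pow_le_pow_left₀ (norm_nonneg _) ?_ 2
    have := round_le ((y - x) i) (m i)
    have hneg : (x + intVec d m - y) i = -((y - x) i - m i) := by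
      simp [intVec]
      ring
    rw [Real.norm_eq_abs, Real.norm_eq_abs, hneg, abs_neg]
    exact this

theorem measurable_fracVec : Measurable (fracVec (d := d)) := by
  have h : Measurable fun w : Euc d => fun i => w i - ((round (w i) : ℤ) : ℝ) := by
    refine measurable_pi_lambda _ fun i => ?_
    have hi : Measurable fun w : Euc d => w i := by fun_prop
    simp_rw [round_eq]
    exact hi.sub (measurable_from_top.comp (Int.measurable_floor.comp (hi.add_const _)))
  exact (WithLp.measurable_toLp 2 _).comp h

theorem measurable_torusDist {α : Type*} [MeasurableSpace α] {g h : α → Euc d} (hg : Measurable g)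
    (hh : Measurable h) : Measurable fun a => torusDist d (g a) (h a) := by
  simp_rw [torusDist_eq_norm_fracVec]
  exact (measurable_fracVec.comp (hh.sub hg)).norm

theorem measurable_torusDist_right (x : Euc d) : Measurable (torusDist d x) :=
  measurable_torusDist measurable_const measurable_id

theorem torusDist_nonneg (x y : Euc d) : 0 ≤ torusDist d x y := by
  rw [torusDist_eq_norm_fracVec]; exact norm_nonneg _

theorem torusDist_add_single (x y : Euc d) (i : Fin d) :
    torusDist d x (y + EuclideanSpace.single i 1) = torusDist d x y := by
  rw [torusDist_eq_norm_fracVec, torusDist_eq_norm_fracVec]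
  congr 1
  ext j
  by_cases hj : j = i
  · subst hj
    simp only [fracVec, PiLp.sub_apply, PiLp.add_apply, PiLp.single_apply, if_true]
    rw [show y j + 1 - x j = y j - x j + 1 by ring, round_add_one]
    push_cast
    ring
  · simp [fracVec, hj]

/-- The centred unit cube. -/
def centredCube (d : ℕ) : Set (Euc d) := {w | ∀ i, w i ∈ Set.Icc (-(1 / 2) : ℝ) (1 / 2)}

theorem norm_le_sqrt_of_abs_le_one {w : Euc d} (hw : ∀ i, |w i| ≤ 1) : ‖w‖ ≤ √d := by
  rw [EuclideanSpace.norm_eq]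
  refine Real.sqrt_le_sqrt ?_
  calc ∑ i, ‖w i‖ ^ 2 ≤ ∑ _i : Fin d, (1 : ℝ) := by
        refine Finset.sum_le_sum fun i _ => ?_
        have := pow_le_pow_left₀ (abs_nonneg (w i)) (hw i) 2
        simpa using this
    _ = d := by simp

theorem torusDist_le_sqrt (x y : Euc d) : torusDist d x y ≤ √d := by
  rw [torusDist_eq_norm_fracVec]
  refine norm_le_sqrt_of_abs_le_one fun i => (abs_sub_round ((y - x) i)).trans (by norm_num)

theorem norm_le_sqrt_of_mem_centredCube {w : Euc d} (hw : w ∈ centredCube d) : ‖w‖ ≤ √d :=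
  norm_le_sqrt_of_abs_le_one fun i => abs_le.2
    ⟨by linarith [(hw i).1], by linarith [(hw i).2]⟩

theorem closedBall_subset_centredCube {r : ℝ} (hr : r ≤ 1 / 2) :
    Metric.closedBall (0 : Euc d) r ⊆ centredCube d := fun w hw i =>
  abs_le.1 ((PiLp.norm_apply_le w i).trans ((mem_closedBall_zero_iff.1 hw).trans hr))

/-- The half-open box with corner `a` and unit sides. -/
def unitBox (a : Euc d) : Set (Euc d) := {y | ∀ i, y i ∈ Set.Ico (a i) (a i + 1)}

theorem unitBox_ae_eq (a : Euc d) :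
    unitBox a =ᵐ[volume] {y : Euc d | ∀ i, y i ∈ Set.Icc (a i) (a i + 1)} := by
  have h := (PiLp.volume_preserving_ofLp (Fin d)).quasiMeasurePreserving.preimage_ae_eq
    (Measure.univ_pi_Ico_ae_eq_Icc (μ := fun _ : Fin d => (volume : Measure ℝ))
      (f := fun i => a i) (g := fun i => a i + 1))
  have h1 : unitBox a = WithLp.ofLp ⁻¹' Set.univ.pi fun i => Set.Ico (a i) (a i + 1) := by
    ext; simp [unitBox]
  have h2 : {y : Euc d | ∀ i, y i ∈ Set.Icc (a i) (a i + 1)} =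
      WithLp.ofLp ⁻¹' Set.Icc (fun i => a i) fun i => a i + 1 := by
    ext y; simp [Pi.le_def, forall_and]
  rw [h1, h2]
  exact h

theorem measurableSet_centredCube : MeasurableSet (centredCube d) := by
  have : centredCube d = ⋂ i, (fun w : Euc d => w i) ⁻¹' Set.Icc (-(1 / 2) : ℝ) (1 / 2) := by
    ext; simp [centredCube]
  rw [this]
  exact MeasurableSet.iInter fun i => measurableSet_Icc.preimage (by fun_prop)

theorem apply_add_of_mem_span {α : Type*} {g : Euc d → α}
    (hg : ∀ x i, g (x + EuclideanSpace.single i 1) = g x) {v : Euc d}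
    (hv : v ∈ Submodule.span ℤ (Set.range (EuclideanSpace.basisFun (Fin d) ℝ).toBasis)) :
    ∀ x, g (v + x) = g x := by
  let P : AddSubgroup (Euc d) :=
    { carrier := {v | ∀ x, g (v + x) = g x}
      zero_mem' := fun x => by rw [zero_add]
      add_mem' := fun {a b} ha hb x => by rw [add_assoc, ha, hb]
      neg_mem' := fun {a} ha x => by rw [← ha (-a + x), add_neg_cancel_left] }
  have hle : Submodule.span ℤ (Set.range (EuclideanSpace.basisFun (Fin d) ℝ).toBasis) ≤
      P.toIntSubmodule := by
    refine Submodule.span_le.2 ?_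
    rintro _ ⟨i, rfl⟩ x
    rw [add_comm]
    simpa using hg x i
  exact hle hv

theorem setLIntegral_unitCube_eq {g : Euc d → ENNReal}
    (hg : ∀ x i, g (x + EuclideanSpace.single i 1) = g x) (x : Euc d) :
    ∫⁻ y in unitCube d, g y = ∫⁻ w in centredCube d, g (x + w) := by
  set b := (EuclideanSpace.basisFun (Fin d) ℝ).toBasis
  have hfd := ZSpan.isAddFundamentalDomain b volume
  set a : Euc d := WithLp.toLp 2 fun i => x i - 1 / 2
  have h1 : ZSpan.fundamentalDomain b = unitBox (0 : Euc d) := by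
    ext y; simp [b, unitBox]
  have h2 : a +ᵥ ZSpan.fundamentalDomain b = unitBox a := by
    ext y
    rw [Set.mem_vadd_set_iff_neg_vadd_mem, h1]
    simp only [unitBox, Set.mem_ofPred_eq]
    refine forall_congr' fun i => ?_
    simp only [vadd_eq_add, Set.mem_Ico, PiLp.add_apply, PiLp.neg_apply, PiLp.zero_apply]
    constructor <;> rintro ⟨h, h'⟩ <;> constructor <;> linarith
  have hfd2 : IsAddFundamentalDomain (Submodule.span ℤ (Set.range b)) (unitBox a) volume := by
    rw [← h2]
    exact hfd.vadd_of_comm a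
  have hcube : unitBox (0 : Euc d) =ᵐ[volume] unitCube d := by
    have := unitBox_ae_eq (0 : Euc d)
    simpa [unitCube] using this
  have hcube2 : unitBox a =ᵐ[volume] (fun w => x + w) '' centredCube d := by
    have : {y : Euc d | ∀ i, y i ∈ Set.Icc (a i) (a i + 1)} =
        (fun w => x + w) '' centredCube d := by
      ext y
      rw [Set.image_add_left, Set.mem_preimage]
      simp only [centredCube, Set.mem_ofPred_eq]
      refine forall_congr' fun i => ?_
      simp only [a, Set.mem_Icc, PiLp.add_apply, PiLp.neg_apply]
      constructor <;> rintro ⟨h, h'⟩ <;> constructor <;> linarith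
    exact (unitBox_ae_eq a).trans (Filter.EventuallyEq.of_eq this)
  have : VAddInvariantMeasure (Submodule.span ℤ (Set.range b)) (Euc d) volume :=
    inferInstanceAs
      (VAddInvariantMeasure (Submodule.span ℤ (Set.range b)).toAddSubgroup (Euc d) volume)
  have key := hfd.setLIntegral_eq hfd2 g fun v y => apply_add_of_mem_span hg v.2 y
  rw [h1, setLIntegral_congr hcube, setLIntegral_congr hcube2] at key
  rw [key]
  exact (measurePreserving_add_left volume x).setLIntegral_comp_emb
    (MeasurableEquiv.addLeft x).measurableEmbedding g (centredCube d) |>.symm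

theorem volume_centredCube : volume (centredCube d) = 1 := by
  have h := setLIntegral_unitCube_eq (d := d) (g := fun _ => 1) (fun _ _ => rfl) 0
  simp only [setLIntegral_const, one_mul] at h
  rw [← h]
  have : unitCube d = WithLp.ofLp ⁻¹' Set.univ.pi fun _ : Fin d => Set.Icc (0 : ℝ) 1 := by
    ext; simp [unitCube, Pi.le_def, forall_and]
  rw [this, (PiLp.volume_preserving_ofLp (Fin d)).measure_preimage
    (MeasurableSet.univ_pi fun _ => measurableSet_Icc).nullMeasurableSet, volume_pi_pi]
  simp

theorem torusDist_add_self {x w : Euc d} (hw : w ∈ unitBox (WithLp.toLp 2 fun _ => -(1 / 2))) :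
    torusDist d x (x + w) = ‖w‖ := by
  rw [torusDist_eq_norm_fracVec]
  congr 1
  ext i
  have h := hw i
  have : round (w i) = 0 := by
    rw [round_eq_zero_iff]
    refine ⟨h.1, h.2.trans_eq (by norm_num)⟩
  simp [fracVec, this]

theorem unitBox_neg_half_ae_eq :
    unitBox (WithLp.toLp 2 fun _ => -(1 / 2) : Euc d) =ᵐ[volume] centredCube d := by
  refine (unitBox_ae_eq _).trans (Filter.EventuallyEq.of_eq ?_)
  have h : (-(1 / 2) + 1 : ℝ) = 1 / 2 := by norm_num
  simp only [centredCube, h]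
  rfl

theorem densityMeasure_torusDist_mem {f : Euc d → ℝ} (hf : IsPeriodic d f) {B : Set ℝ}
    (hB : MeasurableSet B) (x : Euc d) :
    densityMeasure d f {y | torusDist d x y ∈ B} =
      ∫⁻ w in centredCube d ∩ {w | ‖w‖ ∈ B}, ENNReal.ofReal (f (x + w)) := by
  have hS : MeasurableSet {y | torusDist d x y ∈ B} :=
    measurable_torusDist_right x hB
  have hN : MeasurableSet {w : Euc d | ‖w‖ ∈ B} := measurable_norm hB
  rw [densityMeasure, withDensity_apply _ hS, ← lintegral_indicator hS,
    setLIntegral_unitCube_eq _ x]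
  · rw [Set.inter_comm, ← Measure.restrict_restrict hN, ← lintegral_indicator hN,
      ← setLIntegral_congr unitBox_neg_half_ae_eq]
    have hbox : MeasurableSet (unitBox (WithLp.toLp 2 fun _ => -(1 / 2) : Euc d)) := by
      have : unitBox (WithLp.toLp 2 fun _ => -(1 / 2) : Euc d) =
          ⋂ i, (fun w : Euc d => w i) ⁻¹' Set.Ico (-(1 / 2) : ℝ) (-(1 / 2) + 1) := by
        ext; simp [unitBox]
      rw [this]
      exact MeasurableSet.iInter fun i => measurableSet_Ico.preimage (by fun_prop)
    rw [setLIntegral_congr_fun hbox, setLIntegral_congr unitBox_neg_half_ae_eq]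
    intro w hw
    have h := torusDist_add_self (x := x) hw
    by_cases hwB : ‖w‖ ∈ B <;> simp [Set.indicator, h, hwB]
  · intro y i
    have h := torusDist_add_single x y i
    by_cases hyB : torusDist d x y ∈ B <;> simp [Set.indicator, h, hyB, hf y i]

end

section
/-! ### Hölder densities and the mass of small balls -/

variable {d : ℕ} {s L : ℝ} {f : Euc d → ℝ}

theorem IsHolderOrder.continuous (hf : IsHolderOrder d s L f) (hs : 0 < s) : Continuous f := by
  unfold IsHolderOrder at hf
  split_ifs at hf with h
  · refine continuous_iff_continuousAt.2 fun x => ?_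
    rw [ContinuousAt, tendsto_iff_dist_tendsto_zero]
    refine squeeze_zero (fun _ => dist_nonneg) (fun y => (Real.dist_eq _ _).trans_le (hf y x)) ?_
    have : Continuous fun y => L * ‖y - x‖ ^ s :=
      continuous_const.mul ((continuous_id.sub continuous_const).norm.rpow_const
        fun _ => Or.inr hs.le)
    simpa [zero_rpow hs.ne'] using this.tendsto x
  · exact hf.1.continuous

theorem IsHolderOrder.exists_linear_approx (hf : IsHolderOrder d s L f) (hL : 0 ≤ L)
    (x : Euc d) : ∃ φ : Euc d →L[ℝ] ℝ, ∀ w, |f (x + w) - f x - φ w| ≤ L * ‖w‖ ^ s := by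
  unfold IsHolderOrder at hf
  split_ifs at hf with h
  · exact ⟨0, fun w => by simpa using hf (x + w) x⟩
  · refine ⟨fderiv ℝ f x, fun w => ?_⟩
    have hd : Differentiable ℝ f := hf.1.differentiable one_ne_zero
    have hbound : ∀ z ∈ Metric.closedBall x ‖w‖,
        ‖fderiv ℝ f z - fderiv ℝ f x‖ ≤ L * ‖w‖ ^ (s - 1) := by
      intro z hz
      have hgrad : ‖fderiv ℝ f z - fderiv ℝ f x‖ = ‖gradient f z - gradient f x‖ := by
        rw [gradient, gradient, ← map_sub, LinearIsometryEquiv.norm_map]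
      rw [hgrad]
      refine (hf.2 z x).trans (mul_le_mul_of_nonneg_left ?_ hL)
      exact rpow_le_rpow (norm_nonneg _) (mem_closedBall_iff_norm.1 hz) (by linarith)
    have key := (convex_closedBall x ‖w‖).norm_image_sub_le_of_norm_fderiv_le'
      (fun z _ => hd z) hbound (Metric.mem_closedBall_self (norm_nonneg w))
      (y := x + w) (by simp)
    rw [add_sub_cancel_left, Real.norm_eq_abs, mul_assoc] at key
    refine key.trans_eq ?_
    rw [← rpow_add_one' (norm_nonneg _) (by linarith), sub_add_cancel]

theorem setIntegral_continuousLinearMap_eq_zero (φ : Euc d →L[ℝ] ℝ) {A : Set (Euc d)}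
    (hA : MeasurableSet A) (hneg : ∀ w, -w ∈ A ↔ w ∈ A) : ∫ w in A, φ w = 0 := by
  rw [← integral_indicator hA]
  have h := integral_neg_eq_self (A.indicator fun w => φ w) volume
  have h2 : (fun w => A.indicator (fun w => φ w) (-w)) =
      fun w => -A.indicator (fun w => φ w) w := by
    ext w
    by_cases hw : w ∈ A
    · simp [Set.indicator, hneg, hw]
    · simp [Set.indicator, hneg, hw]
  rw [h2, integral_neg] at h
  linarith

theorem Continuous.integrableOn_of_norm_le {E : Type*} [NormedAddCommGroup E] {g : Euc d → E}
    (hg : Continuous g) {A : Set (Euc d)} {r : ℝ} (hr : ∀ w ∈ A, ‖w‖ ≤ r) :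
    IntegrableOn g A :=
  (hg.continuousOn.integrableOn_compact (isCompact_closedBall (0 : Euc d) r)).mono_set
    fun w hw => mem_closedBall_zero_iff.2 (hr w hw)

theorem IsHolderOrder.abs_setIntegral_sub_le (hf : IsHolderOrder d s L f) (hs : 0 < s) (hL : 0 ≤ L)
    (x : Euc d) {A : Set (Euc d)} (hA : MeasurableSet A) (hneg : ∀ w, -w ∈ A ↔ w ∈ A) {r : ℝ}
    (hr : ∀ w ∈ A, ‖w‖ ≤ r) :
    |(∫ w in A, f (x + w)) - f x * volume.real A| ≤ L * r ^ s * volume.real A := by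
  obtain ⟨φ, hφ⟩ := hf.exists_linear_approx hL x
  have hfc : Continuous fun w => f (x + w) :=
    (hf.continuous hs).comp (continuous_const.add continuous_id)
  have hfin : volume A < ⊤ :=
    (measure_mono fun w hw => mem_closedBall_zero_iff.2 (hr w hw)).trans_lt
    (measure_closedBall_lt_top (x := (0 : Euc d)) (r := r))
  have h1 : IntegrableOn (fun w => f (x + w)) A := hfc.integrableOn_of_norm_le hr
  have h2 : IntegrableOn (fun _ : Euc d => f x) A := continuous_const.integrableOn_of_norm_le hr
  have h3 : IntegrableOn (fun w => φ w) A := φ.continuous.integrableOn_of_norm_le hr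
  have heq : ∫ w in A, (f (x + w) - f x - φ w) =
      (∫ w in A, f (x + w)) - f x * volume.real A := by
    rw [integral_sub (f := fun w => f (x + w) - f x) (h1.sub h2) h3, integral_sub h1 h2,
      setIntegral_continuousLinearMap_eq_zero φ hA hneg, setIntegral_const, smul_eq_mul]
    ring
  rw [← heq, ← Real.norm_eq_abs]
  refine norm_setIntegral_le_of_norm_le_const hfin fun w hw => (hφ w).trans ?_
  exact mul_le_mul_of_nonneg_left (rpow_le_rpow (norm_nonneg _) (hr w hw) hs.le) hL

theorem neg_mem_centredCube (w : Euc d) : -w ∈ centredCube d ↔ w ∈ centredCube d := by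
  refine forall_congr' fun i => ?_
  simp only [PiLp.neg_apply, Set.mem_Icc]
  constructor <;> rintro ⟨h, h'⟩ <;> constructor <;> linarith

theorem HolderDensity.continuous (hf : HolderDensity d s L f) (hs : 0 < s) : Continuous f :=
  hf.1.continuous hs

theorem HolderDensity.lintegral_centredCube (hf : HolderDensity d s L f) (hs : 0 < s) (x : Euc d) :
    ∫⁻ w in centredCube d, ENNReal.ofReal (f (x + w)) = 1 := by
  rw [← setLIntegral_unitCube_eq (g := fun y => ENNReal.ofReal (f y))
    (fun y i => by rw [hf.2.1 y i]) x, ← ofReal_integral_eq_lintegral_ofReal, hf.2.2.2,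
    ENNReal.ofReal_one]
  · refine (hf.continuous hs).integrableOn_of_norm_le (r := √d) fun w hw => ?_
    exact norm_le_sqrt_of_abs_le_one fun i => abs_le.2 ⟨by linarith [(hw i).1], (hw i).2⟩
  · exact Filter.Eventually.of_forall hf.2.2.1

theorem HolderDensity.integral_centredCube (hf : HolderDensity d s L f) (hs : 0 < s) (x : Euc d) :
    ∫ w in centredCube d, f (x + w) = 1 := by
  rw [integral_eq_lintegral_of_nonneg_ae (Filter.Eventually.of_forall fun w => hf.2.2.1 _),
    hf.lintegral_centredCube hs, ENNReal.toReal_one]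
  exact ((hf.continuous hs).comp (continuous_const.add continuous_id)).aestronglyMeasurable

theorem HolderDensity.isProbabilityMeasure (hf : HolderDensity d s L f) (hs : 0 < s) :
    IsProbabilityMeasure (densityMeasure d f) := by
  constructor
  rw [densityMeasure, withDensity_apply _ MeasurableSet.univ, Measure.restrict_univ,
    setLIntegral_unitCube_eq (g := fun y => ENNReal.ofReal (f y)) (fun y i => by rw [hf.2.1 y i]) 0,
    hf.lintegral_centredCube hs]

theorem HolderDensity.le_one_add (hf : HolderDensity d s L f) (hs : 0 < s) (hL : 0 ≤ L)
    (x : Euc d) : f x ≤ 1 + L * √d ^ s := by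
  have h := hf.1.abs_setIntegral_sub_le hs hL x measurableSet_centredCube neg_mem_centredCube
    fun w hw => norm_le_sqrt_of_mem_centredCube hw
  rw [hf.integral_centredCube hs, measureReal_def, volume_centredCube] at h
  have := (abs_le.1 h).1
  simp only [ENNReal.toReal_one, mul_one] at this
  linarith

theorem unitBallVol_pos : 0 < unitBallVol d := by
  unfold unitBallVol
  exact div_pos (rpow_pos_of_pos pi_pos _) (Gamma_pos_of_pos (by positivity))

theorem volumeReal_closedBall [NeZero d] {r : ℝ} (hr : 0 ≤ r) :
    volume.real (Metric.closedBall (0 : Euc d) r) = unitBallVol d * r ^ d := by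
  rw [measureReal_def, EuclideanSpace.volume_closedBall]
  rw [ENNReal.toReal_mul, ENNReal.toReal_pow, ENNReal.toReal_ofReal hr, ENNReal.toReal_ofReal,
    unitBallVol, Fintype.card_fin, mul_comm, add_comm]
  · rw [sqrt_eq_rpow, ← rpow_natCast, ← rpow_mul pi_pos.le]
    congr 3
    ring
  · have : 0 < Gamma ((d : ℝ) / 2 + 1) := Gamma_pos_of_pos (by positivity)
    simp only [Fintype.card_fin]
    positivity

/-- The mass given by `f` to the torus ball of radius `r` around `x`. -/
noncomputable def ballMass (d : ℕ) (f : Euc d → ℝ) (x : Euc d) (r : ℝ) : ℝ :=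
  (densityMeasure d f).real {y | torusDist d x y ≤ r}

theorem HolderDensity.ballMass_eq (hf : HolderDensity d s L f) (hs : 0 < s) (x : Euc d) (r : ℝ) :
    ballMass d f x r = ∫ w in centredCube d ∩ Metric.closedBall 0 r, f (x + w) := by
  have h := densityMeasure_torusDist_mem hf.2.1 (measurableSet_Iic (a := r)) x
  simp only [Set.mem_Iic] at h
  have hfc : Continuous fun w => f (x + w) :=
    (hf.continuous hs).comp (continuous_const.add continuous_id)
  rw [ballMass, measureReal_def, h,
    integral_eq_lintegral_of_nonneg_ae (Filter.Eventually.of_forall fun w => hf.2.2.1 _)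
    hfc.aestronglyMeasurable]
  congr 4
  ext w
  simp

theorem HolderDensity.abs_ballMass_sub_le [NeZero d] (hf : HolderDensity d s L f) (hs : 0 < s)
    (hL : 0 ≤ L) (x : Euc d) {r : ℝ} (hr : 0 ≤ r) :
    |ballMass d f x r - f x * (unitBallVol d * r ^ d)| ≤
      (L + (1 + L * √d ^ s) * 2 ^ s) * r ^ s * (unitBallVol d * r ^ d) := by
  set A := centredCube d ∩ Metric.closedBall 0 r
  have hA : MeasurableSet A :=
    measurableSet_centredCube.inter Metric.isClosed_closedBall.measurableSet
  have hle : volume.real A ≤ unitBallVol d * r ^ d := by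
    rw [← volumeReal_closedBall hr]
    exact measureReal_mono Set.inter_subset_right (measure_closedBall_lt_top).ne
  have h1 : |ballMass d f x r - f x * volume.real A| ≤ L * r ^ s * (unitBallVol d * r ^ d) := by
    rw [hf.ballMass_eq hs]
    refine (hf.1.abs_setIntegral_sub_le hs hL x hA (fun w => ?_) (r := r) fun w hw => ?_).trans ?_
    · simp [A, neg_mem_centredCube]
    · exact mem_closedBall_zero_iff.1 hw.2
    · exact mul_le_mul_of_nonneg_left hle (by positivity)
  have h2 : |f x * volume.real A - f x * (unitBallVol d * r ^ d)| ≤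
      (1 + L * √d ^ s) * 2 ^ s * r ^ s * (unitBallVol d * r ^ d) := by
    have hV : 0 ≤ unitBallVol d := unitBallVol_pos.le
    rcases le_or_gt r (1 / 2) with hr2 | hr2
    · have : A = Metric.closedBall 0 r :=
        Set.inter_eq_right.2 (closedBall_subset_centredCube hr2)
      rw [this, volumeReal_closedBall hr, sub_self, abs_zero]
      positivity
    · have h2r : 1 ≤ 2 ^ s * r ^ s := by
        rw [← mul_rpow (by norm_num) hr]
        exact one_le_rpow (by linarith) hs.le
      rw [← mul_sub, abs_mul, abs_of_nonneg (hf.2.2.1 x), mul_assoc, mul_assoc]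
      refine mul_le_mul (hf.le_one_add hs hL x) ?_ (abs_nonneg _) (by positivity)
      rw [abs_sub_comm, abs_of_nonneg (sub_nonneg.2 hle)]
      have h0 : 0 ≤ volume.real A := measureReal_nonneg
      have hVr : 0 ≤ unitBallVol d * r ^ d := by positivity
      nlinarith [mul_le_mul_of_nonneg_right h2r hVr]
  calc _ ≤ _ := abs_sub_le _ (f x * volume.real A) _
    _ ≤ _ := add_le_add h1 h2
    _ = _ := by ring

theorem HolderDensity.ballMass_le [NeZero d] (hf : HolderDensity d s L f) (hs : 0 < s)
    (hL : 0 ≤ L) (x : Euc d) {r : ℝ} (hr : 0 ≤ r) :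
    ballMass d f x r ≤ (1 + L * √d ^ s) * (unitBallVol d * r ^ d) := by
  rw [hf.ballMass_eq hs, ← volumeReal_closedBall hr]
  have hfin : volume (Metric.closedBall (0 : Euc d) r) < ⊤ := measure_closedBall_lt_top
  have hsub : centredCube d ∩ Metric.closedBall 0 r ⊆ Metric.closedBall 0 r :=
    Set.inter_subset_right
  have hbound : ∀ w ∈ centredCube d ∩ Metric.closedBall 0 r, ‖f (x + w)‖ ≤ 1 + L * √d ^ s := by
    intro w _
    rw [Real.norm_eq_abs, abs_of_nonneg (hf.2.2.1 _)]
    exact hf.le_one_add hs hL _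
  refine (le_abs_self _).trans ((norm_setIntegral_le_of_norm_le_const
    ((measure_mono hsub).trans_lt hfin) hbound).trans ?_)
  exact mul_le_mul_of_nonneg_left (measureReal_mono hsub hfin.ne) (by positivity)

theorem HolderDensity.nullSingletonClass_map [NeZero d] (hf : HolderDensity d s L f) (x : Euc d) :
    NullSingletonClass ((densityMeasure d f).map (torusDist d x)) := by
  constructor
  intro r
  have hm := measurable_torusDist_right x
  rw [Measure.map_apply hm (measurableSet_singleton r)]
  have h := densityMeasure_torusDist_mem hf.2.1 (measurableSet_singleton r) x
  have hnull : volume (centredCube d ∩ {w : Euc d | ‖w‖ ∈ ({r} : Set ℝ)}) = 0 := by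
    refine measure_mono_null Set.inter_subset_right ?_
    have : {w : Euc d | ‖w‖ ∈ ({r} : Set ℝ)} = Metric.sphere 0 r := by ext; simp
    rw [this, Measure.addHaar_sphere]
  rw [Measure.restrict_eq_zero.2 hnull, lintegral_zero_measure] at h
  exact h

theorem HolderDensity.cdf_map (hf : HolderDensity d s L f) (hs : 0 < s) (x : Euc d) (r : ℝ) :
    ProbabilityTheory.cdf ((densityMeasure d f).map (torusDist d x)) r = ballMass d f x r := by
  have hm := measurable_torusDist_right x
  have := hf.isProbabilityMeasure hs
  have := Measure.isProbabilityMeasure_map hm.aemeasurable (μ := densityMeasure d f)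
  rw [ProbabilityTheory.cdf_eq_real, measureReal_def, Measure.map_apply hm measurableSet_Iic]
  rfl

theorem HolderDensity.ballMass_mono (hf : HolderDensity d s L f) (hs : 0 < s) (x : Euc d) :
    Monotone (ballMass d f x) := fun r r' h => by
  have := hf.isProbabilityMeasure hs
  exact measureReal_mono fun y hy => le_trans (Set.mem_ofPred_eq.mp hy) h

end

section
/-! ### Logarithmic error of the local density estimate -/

theorem mul_log_div_le {a g : ℝ} (ha : 0 < a) (hg : 0 < g) : g * log (a / g) ≤ a := by
  have h := log_le_self (x := a / g) (by positivity)
  calc g * log (a / g) ≤ g * (a / g) := mul_le_mul_of_nonneg_left h hg.le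
    _ = a := by field_simp

theorem mul_abs_log_le {a g M : ℝ} (ha : 0 < a) (hg : 0 < g) (hgM : g ≤ M) :
    g * |log g| ≤ a + g * (|log a| + |log M|) := by
  have h1 : 0 ≤ g * |log a| := by positivity
  have h2 : 0 ≤ g * |log M| := by positivity
  rcases le_total 1 g with h | h
  · rw [abs_of_nonneg (log_nonneg h)]
    have : g * log g ≤ g * |log M| :=
      mul_le_mul_of_nonneg_left ((log_le_log hg hgM).trans (le_abs_self _)) hg.le
    linarith
  · rw [abs_of_nonpos (log_nonpos hg.le h)]
    have h3 := mul_log_div_le ha hg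
    rw [log_div ha.ne' hg.ne'] at h3
    have h4 : g * -log a ≤ g * |log a| := mul_le_mul_of_nonneg_left (neg_le_abs _) hg.le
    linarith

theorem mul_abs_log_div_le {g q e : ℝ} (hg : 0 < g) (hq : |q - g| ≤ e) (he : e ≤ g / 2) :
    g * |log (g / q)| ≤ 2 * e := by
  obtain ⟨h1, h2⟩ := abs_le.1 hq
  have hq2 : g / 2 ≤ q := by linarith
  have hq0 : 0 < q := by linarith
  have he0 : 0 ≤ e := (abs_nonneg _).trans hq
  rw [← le_div_iff₀' hg, abs_le]
  constructor
  · have h3 := log_le_sub_one_of_pos (x := q / g) (by positivity)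
    have h5 : log (q / g) = -log (g / q) := by rw [← log_inv, inv_div]
    have h4 : q / g - 1 ≤ 2 * e / g := by
      rw [div_sub_one hg.ne']
      gcongr
      linarith
    linarith
  · refine (log_le_sub_one_of_pos (by positivity)).trans ?_
    rw [div_sub_one hq0.ne', div_le_div_iff₀ hq0 hg]
    nlinarith

theorem rpow_le_one_add_sq {t p : ℝ} (ht : 0 ≤ t) (hp : 0 ≤ p) (hp2 : p ≤ 2) :
    t ^ p ≤ 1 + t ^ 2 := by
  rcases le_total t 1 with h | h
  · linarith [rpow_le_one ht h hp, sq_nonneg t]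
  · have := rpow_le_rpow_of_exponent_le h hp2
    rw [rpow_two] at this
    linarith

theorem le_mul_of_rpow_le {a g p N : ℝ} (ha : 0 < a) (hp : 1 ≤ p)
    (hN : 0 ≤ N) (h : (g / a) ^ p ≤ N) : g ≤ a * (1 + N) := by
  rw [mul_comm, ← div_le_iff₀ ha]
  rcases le_total (g / a) 1 with h1 | h1
  · linarith
  · have := rpow_le_rpow_of_exponent_le h1 hp
    rw [rpow_one] at this
    linarith

variable {d : ℕ} {s C V M : ℝ}

/-- When the radius is small compared with the density, the local estimate is accurate. -/
theorem mul_abs_log_le_of_small_radius (hd : 1 ≤ d) (hs : 0 < s) (hs2 : s ≤ 2) (hC : 0 < C)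
    (hV : 0 < V) {n : ℕ} (hn : 0 < n) {g R U : ℝ} (hR : 0 < R) (hU : 0 < U)
    (hUg : |U / (V * R ^ d) - g| ≤ C * R ^ s) (hga : (n : ℝ) ^ (-(s / (s + d))) ≤ g)
    (hCR : C * R ^ s ≤ g / 2) :
    g * |log (g / (U / (V * R ^ d)))| ≤
      2 * C * (2 / V) ^ (s / d) * (n : ℝ) ^ (-(s / (s + d))) * (1 + (n * U) ^ 2) := by
  set a := (n : ℝ) ^ (-(s / (s + d)))
  have hn' : (0 : ℝ) < n := by exact_mod_cast hn
  have hd' : (1 : ℝ) ≤ d := by exact_mod_cast hd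
  have ha : 0 < a := rpow_pos_of_pos hn' _
  have hg : 0 < g := ha.trans_le hga
  have h1 := mul_abs_log_div_le hg hUg hCR
  have hq : g / 2 ≤ U / (V * R ^ d) := by linarith [(abs_le.1 hUg).1]
  have hRd : R ^ d ≤ 2 / V * (n * U) * (1 / (n * a)) := by
    rw [le_div_iff₀ (by positivity)] at hq
    have : a / 2 * (V * R ^ d) ≤ U :=
      (mul_le_mul_of_nonneg_right (by linarith) (by positivity)).trans hq
    have : R ^ d ≤ U / (a / 2 * V) := by
      rw [le_div_iff₀ (by positivity)]
      linarith
    refine this.trans_eq ?_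
    field_simp
  have hRs : R ^ s ≤ (2 / V) ^ (s / d) * (1 + (n * U) ^ 2) * a := by
    have e1 : R ^ s = (R ^ d) ^ (s / d) := by
      rw [← rpow_natCast, ← rpow_mul hR.le]
      congr 1
      field_simp
    have e2 : (1 / (n * a)) ^ (s / d) = a := by
      have : (n : ℝ) * a = n ^ ((d : ℝ) / (s + d)) := by
        rw [← rpow_one_add' hn'.le]
        · congr 1
          field_simp
          ring
        · have : s / (s + d) < 1 := by rw [div_lt_one (by positivity)]; linarith
          linarith
      rw [this, one_div, ← rpow_neg hn'.le, ← rpow_mul hn'.le]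
      congr 1
      field_simp
    have hsd : s / d ≤ 2 := by
      rw [div_le_iff₀ (by linarith)]
      linarith
    rw [e1]
    refine (rpow_le_rpow (by positivity) hRd (by positivity)).trans ?_
    rw [mul_rpow (by positivity) (by positivity), mul_rpow (by positivity) (by positivity), e2]
    gcongr
    exact rpow_le_one_add_sq (by positivity) (by positivity) hsd
  calc _ ≤ 2 * (C * R ^ s) := h1
    _ ≤ 2 * (C * ((2 / V) ^ (s / d) * (1 + (n * U) ^ 2) * a)) := by gcongr
    _ = _ := by ring

/-- When the radius is large compared with the density, the density itself is small. -/
theorem le_of_large_radius (hs : 0 < s) (hC : 0 < C)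
    (hV : 0 < V) {n : ℕ} (hn : 0 < n) {F : ℝ → ℝ} (hF : Monotone F) {g R : ℝ} (hg : 0 < g)
    (hFg : ∀ r, 0 ≤ r → |F r - g * (V * r ^ d)| ≤ C * r ^ s * (V * r ^ d))
    (hR : 0 < R) (hCR : g / 2 ≤ C * R ^ s) :
    g ≤ (n : ℝ) ^ (-(s / (s + d))) * (1 + 2 / V * (2 * C) ^ (d / s) * (n * F R)) := by
  set a := (n : ℝ) ^ (-(s / (s + d)))
  have hn' : (0 : ℝ) < n := by exact_mod_cast hn
  have ha : 0 < a := rpow_pos_of_pos hn' _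
  set r := (g / (2 * C)) ^ (1 / s)
  have hr : 0 < r := rpow_pos_of_pos (by positivity) _
  have hrs : r ^ s = g / (2 * C) := by
    rw [← rpow_mul (by positivity), one_div_mul_cancel hs.ne', rpow_one]
  have hrd : r ^ d = g ^ (d / s) / (2 * C) ^ (d / s) := by
    rw [← rpow_natCast, ← rpow_mul (by positivity), ← div_rpow hg.le (by positivity)]
    congr 1
    ring
  have hrR : r ≤ R := by
    rw [← rpow_le_rpow_iff hr.le hR.le hs, hrs, div_le_iff₀ (by positivity)]
    linarith
  have h1 : g / 2 * (V * r ^ d) ≤ F R := by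
    have h2 := (abs_le.1 (hFg r hr.le)).1
    have h3 : C * r ^ s = g / 2 := by
      rw [hrs]
      field_simp
    rw [h3] at h2
    linarith [hF hrR]
  have hFR : 0 ≤ F R := le_trans (by positivity) h1
  have hds : 0 ≤ (d : ℝ) / s := by positivity
  refine le_mul_of_rpow_le (p := 1 + d / s) ha (by linarith) (by positivity) ?_
  have hap : a ^ (1 + d / s) = 1 / n := by
    rw [← rpow_mul hn'.le, one_div, ← rpow_neg_one]
    congr 1
    field_simp
  rw [div_rpow hg.le ha.le, hap, rpow_add hg, rpow_one]
  have h4 : g * g ^ (d / s) ≤ 2 / V * (2 * C) ^ (d / s) * F R := by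
    rw [hrd] at h1
    have hpos : 0 < (2 * C) ^ (d / s) := by positivity
    calc g * g ^ (d / s) = 2 / V * (2 * C) ^ (d / s) *
        (g / 2 * (V * (g ^ (d / s) / (2 * C) ^ (d / s)))) := by field_simp
      _ ≤ _ := by gcongr
  calc g * g ^ (d / s) / (1 / n) = g * g ^ (d / s) * n := by field_simp
    _ ≤ 2 / V * (2 * C) ^ (d / s) * F R * n := by gcongr
    _ = _ := by ring

theorem one_le_log_add_one {n : ℕ} (hn : 2 ≤ n) : 1 ≤ log (n + 1 : ℝ) := by
  have : (2 : ℝ) ≤ n := by exact_mod_cast hn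
  rw [le_log_iff_exp_le (by positivity)]
  linarith [exp_one_lt_d9]

theorem natCast_mul_abs_log_le {n : ℕ} (hn : 0 < n) {U : ℝ} (hU : 0 < U) (hU1 : U ≤ 1) :
    n * U * |log U| ≤ 1 + n * U * log n := by
  have hn' : (0 : ℝ) < n := by exact_mod_cast hn
  have h := mul_log_div_le one_pos (show 0 < n * U by positivity)
  rw [log_div one_ne_zero (by positivity), log_one, log_mul hn'.ne' hU.ne'] at h
  rw [abs_of_nonpos (log_nonpos hU.le hU1)]
  linarith

theorem one_add_mul_add_le {t l c u : ℝ} (hl : 1 ≤ l) (hc : 0 ≤ c) (hu : 0 ≤ u)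
    (htu : t * u ≤ 1 + t * l) :
    (1 + t) * (l + c + u) ≤ (4 + 2 * c) * ((1 + t ^ 2) * l + u) := by
  have e2 : t ≤ (1 + t ^ 2) / 2 := by linarith [sq_nonneg (t - 1)]
  have e3 : t * l ≤ (1 + t ^ 2) / 2 * l := mul_le_mul_of_nonneg_right e2 (by linarith)
  have e4 : (1 + t) * c ≤ 2 * (1 + t ^ 2) * c :=
    mul_le_mul_of_nonneg_right (by linarith [sq_nonneg t]) hc
  have e5 : (1 + t ^ 2) * c ≤ (1 + t ^ 2) * c * l := le_mul_of_one_le_right (by positivity) hl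
  have e6 : 0 ≤ t ^ 2 * l := by positivity
  have e7 : 0 ≤ c * u := by positivity
  linarith

/-- When the density is small, the local error is small because of the factor `g`. -/
theorem mul_abs_log_le_of_small_density (hs : 0 < s) (hV : 0 < V) {D K₀ : ℝ}
    (hK₀ : 1 ≤ K₀) {n : ℕ} (hn : 2 ≤ n) {g R U : ℝ} (hg : 0 < g) (hgM : g ≤ M)
    (hR : 0 < R) (hRD : R ≤ D) (hU : 0 < U) (hU1 : U ≤ 1) (hUM : U ≤ M * (V * R ^ d))
    (hgK : g ≤ K₀ * (n : ℝ) ^ (-(s / (s + d))) * (1 + n * U)) :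
    g * |log (g / (U / (V * R ^ d)))| ≤
      (5 + 2 * (2 * |log M| + |log (V * D ^ d)|)) * K₀ * (n : ℝ) ^ (-(s / (s + d))) *
        ((1 + (n * U) ^ 2) * log (n + 1) + |log U|) := by
  set a := (n : ℝ) ^ (-(s / (s + d)))
  set c := 2 * |log M| + |log (V * D ^ d)|
  have hn' : (2 : ℝ) ≤ n := by exact_mod_cast hn
  have ha : 0 < a := rpow_pos_of_pos (by linarith) _
  have hc : 0 ≤ c := by positivity
  have hlog1 := one_le_log_add_one hn
  have hlogn : log n ≤ log (n + 1) := log_le_log (by linarith) (by linarith)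
  have hlogn0 : 0 ≤ log (n : ℝ) := log_nonneg (by linarith)
  have hloga : |log a| ≤ log n := by
    rw [log_rpow (by linarith), abs_mul, abs_neg, abs_of_nonneg hlogn0,
      abs_of_nonneg (by positivity)]
    have : s / (s + d) ≤ 1 := by
      rw [div_le_one (by positivity)]
      linarith [Nat.cast_nonneg (α := ℝ) d]
    nlinarith
  have hq : |log (U / (V * R ^ d))| ≤ |log U| + (|log M| + |log (V * D ^ d)|) := by
    have hb : 0 < V * R ^ d := by positivity
    rw [abs_le]
    constructor
    · rw [log_div hU.ne' hb.ne']
      have h1 : log (V * R ^ d) ≤ log (V * D ^ d) := log_le_log hb (by gcongr)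
      linarith [neg_abs_le (log U), le_abs_self (log (V * D ^ d)), abs_nonneg (log M)]
    · have h1 : log (U / (V * R ^ d)) ≤ log M :=
        log_le_log (by positivity) ((div_le_iff₀ hb).2 hUM)
      linarith [le_abs_self (log M), abs_nonneg (log U), abs_nonneg (log (V * D ^ d))]
  have h1 : |log (g / (U / (V * R ^ d)))| ≤ |log g| + |log (U / (V * R ^ d))| := by
    rw [log_div hg.ne' (by positivity)]
    exact abs_sub _ _
  have h2 : g * |log (g / (U / (V * R ^ d)))| ≤ a + g * (log (n + 1) + c + |log U|) := by
    calc _ ≤ g * (|log g| + |log (U / (V * R ^ d))|) := by gcongr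
      _ = g * |log g| + g * |log (U / (V * R ^ d))| := by ring
      _ ≤ (a + g * (log (n + 1) + |log M|)) + g * (|log U| + (|log M| + |log (V * D ^ d)|)) := by
        refine add_le_add ((mul_abs_log_le ha hg hgM).trans ?_) ?_
        · gcongr
          exact hloga.trans hlogn
        · gcongr
      _ = _ := by ring
  have ht : 0 ≤ (n : ℝ) * U := by positivity
  have htU := natCast_mul_abs_log_le (show 0 < n by omega) hU hU1
  set t := (n : ℝ) * U
  set l := log (n + 1 : ℝ)
  set u := |log U|
  have hu : 0 ≤ u := abs_nonneg _
  have h3 : (1 + t) * (l + c + u) ≤ (4 + 2 * c) * ((1 + t ^ 2) * l + u) :=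
    one_add_mul_add_le hlog1 hc hu
      (htU.trans (by linarith [mul_le_mul_of_nonneg_left hlogn ht]))
  have h4 : a ≤ K₀ * a * ((1 + t ^ 2) * l + u) := by
    have : 1 ≤ (1 + t ^ 2) * l + u := by nlinarith [sq_nonneg t]
    have hKa : a ≤ K₀ * a := by nlinarith
    nlinarith
  calc _ ≤ a + g * (l + c + u) := h2
    _ ≤ a + K₀ * a * (1 + t) * (l + c + u) := by
      gcongr
    _ = a + K₀ * a * ((1 + t) * (l + c + u)) := by ring
    _ ≤ K₀ * a * ((1 + t ^ 2) * l + u) + K₀ * a * ((4 + 2 * c) * ((1 + t ^ 2) * l + u)) := by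
      gcongr
    _ = _ := by ring

theorem exists_mul_abs_log_le (hd : 1 ≤ d) (hs : 0 < s) (hs2 : s ≤ 2) (hC : 0 < C)
    (hV : 0 < V) (D M : ℝ) :
    ∃ K : ℝ, 0 < K ∧ ∀ n : ℕ, 2 ≤ n → ∀ (F : ℝ → ℝ) (g R : ℝ), Monotone F →
      (∀ r, 0 ≤ r → |F r - g * (V * r ^ d)| ≤ C * r ^ s * (V * r ^ d)) →
      0 ≤ g → g ≤ M → 0 < R → R ≤ D → 0 < F R → F R ≤ 1 → F R ≤ M * (V * R ^ d) →
      g * |log (g / (F R / (V * R ^ d)))| ≤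
        K * (n : ℝ) ^ (-(s / (s + d))) * ((1 + (n * F R) ^ 2) * log (n + 1) + |log (F R)|) := by
  set K₀ := 1 + 2 / V * (2 * C) ^ (d / s)
  set K₁ := (5 + 2 * (2 * |log M| + |log (V * D ^ d)|)) * K₀
  set K₂ := 2 * C * (2 / V) ^ (s / d)
  have hK₀ : 1 ≤ K₀ := le_add_of_nonneg_right (by positivity)
  have hK₁ : 0 < K₁ := by positivity
  have hK₂ : 0 < K₂ := by positivity
  refine ⟨K₁ + K₂, by positivity, fun n hn F g R hF hFg hg0 hgM hR hRD hU hU1 hUM => ?_⟩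
  rcases hg0.eq_or_lt with rfl | hg
  · have := one_le_log_add_one hn
    rw [zero_mul]
    positivity
  set a := (n : ℝ) ^ (-(s / (s + d)))
  have ha : 0 < a := rpow_pos_of_pos (Nat.cast_pos.2 (by omega)) _
  have hlog1 := one_le_log_add_one hn
  have hsmall : g ≤ K₀ * a * (1 + n * F R) →
      g * |log (g / (F R / (V * R ^ d)))| ≤
        (K₁ + K₂) * a * ((1 + (n * F R) ^ 2) * log (n + 1) + |log (F R)|) := fun h => by
    refine (mul_abs_log_le_of_small_density hs hV hK₀ hn hg hgM hR hRD hU hU1 hUM h).trans ?_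
    change K₁ * a * _ ≤ _
    gcongr
    linarith
  rcases le_total (g / 2) (C * R ^ s) with h | h
  · refine hsmall ((le_of_large_radius hs hC hV (show 0 < n by omega) hF hg hFg hR h).trans ?_)
    have hB : 0 ≤ 2 / V * (2 * C) ^ (d / s) := by positivity
    have hnU : 0 ≤ n * F R := by positivity
    have : 1 + 2 / V * (2 * C) ^ (d / s) * (n * F R) ≤ K₀ * (1 + n * F R) := by
      simp only [K₀]
      nlinarith
    calc _ ≤ a * (K₀ * (1 + n * F R)) := by gcongr
      _ = _ := by ring
  · rcases le_total g a with hga | hga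
    · refine hsmall (hga.trans ?_)
      have hnU : 0 ≤ n * F R := by positivity
      have : 1 ≤ K₀ * (1 + n * F R) := by nlinarith
      nlinarith
    · have hb : 0 < V * R ^ d := by positivity
      have hq : |F R / (V * R ^ d) - g| ≤ C * R ^ s := by
        rw [div_sub' hb.ne', abs_div, abs_of_pos hb, div_le_iff₀ hb, mul_comm _ g]
        exact hFg R hR.le
      refine (mul_abs_log_le_of_small_radius hd hs hs2 hC hV (show 0 < n by omega) hR hU hq hga
        h).trans ?_
      change K₂ * a * _ ≤ _
      have : 1 + (n * F R) ^ 2 ≤ (1 + (n * F R) ^ 2) * log (n + 1) + |log (F R)| := by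
        nlinarith [abs_nonneg (log (F R)), sq_nonneg (n * F R)]
      gcongr
      linarith

end

section
/-! ### The digamma function at positive integers -/

theorem digamma_add_one (n : ℕ) :
    digamma ((n : ℝ) + 1) = (harmonic n : ℝ) - eulerMascheroniConstant := by
  have h := hasDerivAt_Gamma_nat n
  have hG : Gamma ((n : ℝ) + 1) = n.factorial := Gamma_nat_eq_factorial n
  have hne : (n.factorial : ℝ) ≠ 0 := by positivity
  have := (h.log (by rw [hG]; exact hne)).deriv
  rw [digamma, this, hG]
  field_simp
  ring

theorem digamma_add_sum_eq {k m : ℕ} (hk : 1 ≤ k) (hkm : k ≤ m) :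
    digamma k + ∑ j ∈ Finset.Icc k m, (1 : ℝ) / j = digamma ((m : ℝ) + 1) := by
  induction m, hkm using Nat.le_induction with
  | base =>
    obtain ⟨j, rfl⟩ : ∃ j, k = j + 1 := ⟨k - 1, by omega⟩
    rw [Finset.Icc_self, Finset.sum_singleton]
    rw [digamma_add_one, harmonic_succ, Nat.cast_succ, digamma_add_one]
    push_cast
    ring
  | succ m hm ih =>
    rw [Finset.sum_Icc_succ_top (by omega), ← add_assoc, ih, digamma_add_one, digamma_add_one,
      harmonic_succ]
    push_cast
    ring

theorem abs_log_sub_digamma_le {n : ℕ} (hn : 1 ≤ n) : |log n - digamma n| ≤ 1 / n := by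
  obtain ⟨m, rfl⟩ : ∃ m, n = m + 1 := ⟨n - 1, by omega⟩
  have h1 := eulerMascheroniSeq_lt_eulerMascheroniConstant m
  have h2 := eulerMascheroniConstant_lt_eulerMascheroniSeq' (m + 1)
  rw [eulerMascheroniSeq] at h1
  rw [eulerMascheroniSeq', if_neg (by omega), harmonic_succ] at h2
  push_cast at h1 h2 ⊢
  rw [digamma_add_one, one_div, abs_le]
  constructor <;> linarith [show (0 : ℝ) ≤ (m + 1 : ℝ)⁻¹ by positivity]

end

section
/-! ### Nearest-neighbour radius and the mass of the nearest-neighbour ball -/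

variable {d k m : ℕ} {s L : ℝ} {f : Euc d → ℝ}

/-- The distance from `x` to its `k`-th nearest neighbour among the points `Y j`. -/
noncomputable def nnRadius (d k : ℕ) {m : ℕ} (p : Euc d × (Fin m → Euc d)) : ℝ :=
  orderStat k fun j => torusDist d p.1 (p.2 j)

/-- The mass of the nearest-neighbour ball. -/
noncomputable def nnMass (d k : ℕ) {m : ℕ} (f : Euc d → ℝ) (p : Euc d × (Fin m → Euc d)) : ℝ :=
  ballMass d f p.1 (nnRadius d k p)

theorem nnDist_eq_nnRadius (X : Fin (m + 1) → Euc d) (i : Fin (m + 1)) :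
    nnDist d (m + 1) X i k = nnRadius d k (X i, fun j => X (i.succAbove j)) := by
  have h : Finset.univ.erase i = Finset.univ.map i.succAboveEmb := by
    ext j
    simp only [Finset.mem_erase, Finset.mem_univ, and_true, Finset.mem_map, true_and,
      Fin.coe_succAboveEmb]
    exact Fin.exists_succAbove_eq_iff.symm
  rw [nnDist, nnRadius, orderStat, h, Finset.map_val, Multiset.map_map]
  rfl

theorem nnRadius_nonneg (hk : 1 ≤ k) (hkm : k ≤ m) (p : Euc d × (Fin m → Euc d)) :
    0 ≤ nnRadius d k p := by
  obtain ⟨j, hj⟩ := exists_orderStat_eq hk hkm fun j => torusDist d p.1 (p.2 j)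
  exact (torusDist_nonneg _ _).trans_eq hj.symm

theorem nnRadius_le_sqrt (hk : 1 ≤ k) (hkm : k ≤ m) (p : Euc d × (Fin m → Euc d)) :
    nnRadius d k p ≤ √d := by
  obtain ⟨j, hj⟩ := exists_orderStat_eq hk hkm fun j => torusDist d p.1 (p.2 j)
  exact hj.trans_le (torusDist_le_sqrt _ _)

theorem measurable_nnRadius (hk : 1 ≤ k) (hkm : k ≤ m) :
    Measurable (nnRadius d k : Euc d × (Fin m → Euc d) → ℝ) := by
  have h : Measurable fun (p : Euc d × (Fin m → Euc d)) j => torusDist d p.1 (p.2 j) :=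
    measurable_pi_lambda _ fun j =>
      measurable_torusDist measurable_fst ((measurable_pi_apply j).comp measurable_snd)
  exact (measurable_orderStat hk hkm).comp h

theorem HolderDensity.measurable_ballMass (hf : HolderDensity d s L f) (hs : 0 < s) :
    Measurable fun q : Euc d × ℝ => ballMass d f q.1 q.2 := by
  have := hf.isProbabilityMeasure hs
  have hS : MeasurableSet {q : (Euc d × ℝ) × Euc d | torusDist d q.1.1 q.2 ≤ q.1.2} :=
    measurableSet_le (measurable_torusDist (measurable_fst.comp measurable_fst) measurable_snd)
      (measurable_snd.comp measurable_fst)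
  have h : Measurable fun q : Euc d × ℝ => densityMeasure d f (Prod.mk q ⁻¹'
      {q : (Euc d × ℝ) × Euc d | torusDist d q.1.1 q.2 ≤ q.1.2}) :=
    measurable_measure_prodMk_left hS
  exact h.ennreal_toReal

theorem HolderDensity.measurable_nnMass (hf : HolderDensity d s L f) (hs : 0 < s) (hk : 1 ≤ k)
    (hkm : k ≤ m) : Measurable fun p : Euc d × (Fin m → Euc d) => nnMass d k f p := by
  have h : Measurable fun p : Euc d × (Fin m → Euc d) => (p.1, nnRadius d k p) :=
    measurable_fst.prodMk (measurable_nnRadius hk hkm)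
  unfold nnMass
  have h2 := (hf.measurable_ballMass hs).comp h
  simpa only [Function.comp_def] using h2

theorem HolderDensity.nnMass_le_one (hf : HolderDensity d s L f) (hs : 0 < s)
    (p : Euc d × (Fin m → Euc d)) : nnMass d k f p ≤ 1 := by
  have := hf.isProbabilityMeasure hs
  exact measureReal_le_one

theorem HolderDensity.nnRadius_pos [NeZero d] (hf : HolderDensity d s L f) (hs : 0 < s)
    (hL : 0 ≤ L) (hk : 1 ≤ k) (hkm : k ≤ m) {p : Euc d × (Fin m → Euc d)}
    (hp : 0 < nnMass d k f p) : 0 < nnRadius d k p := by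
  refine (nnRadius_nonneg hk hkm p).lt_of_ne fun h => hp.not_ge ?_
  have := hf.ballMass_le hs hL p.1 (nnRadius_nonneg hk hkm p)
  rw [← h] at this
  rw [nnMass, ← h]
  simpa [NeZero.ne d] using this

theorem HolderDensity.map_pi (hf : HolderDensity d s L f) (hs : 0 < s) (x : Euc d) :
    (Measure.pi fun _ : Fin m => densityMeasure d f).map (fun Y j => torusDist d x (Y j)) =
      Measure.pi fun _ : Fin m => (densityMeasure d f).map (torusDist d x) := by
  have := hf.isProbabilityMeasure hs
  have := Measure.isProbabilityMeasure_map (measurable_torusDist_right x).aemeasurable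
    (μ := densityMeasure d f)
  exact Measure.pi_map_pi (f := fun _ => torusDist d x)
    fun _ => (measurable_torusDist_right x).aemeasurable

theorem measurable_torusDist_pi (x : Euc d) :
    Measurable fun (Y : Fin m → Euc d) j => torusDist d x (Y j) :=
  measurable_pi_lambda _ fun j => (measurable_torusDist_right x).comp (measurable_pi_apply j)

theorem HolderDensity.ae_nnMass_pos [NeZero d] (hf : HolderDensity d s L f) (hs : 0 < s)
    (hk : 1 ≤ k) (hkm : k ≤ m) (x : Euc d) :
    ∀ᵐ Y ∂(Measure.pi fun _ : Fin m => densityMeasure d f), 0 < nnMass d k f (x, Y) := by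
  have := hf.isProbabilityMeasure hs
  have := Measure.isProbabilityMeasure_map (measurable_torusDist_right x).aemeasurable
    (μ := densityMeasure d f)
  have := hf.nullSingletonClass_map x
  have h := ae_cdf_orderStat_pos ((densityMeasure d f).map (torusDist d x)) hk hkm
  rw [← hf.map_pi hs] at h
  have h2 := ae_of_ae_map (measurable_torusDist_pi x).aemeasurable h
  simpa only [hf.cdf_map hs, nnMass, nnRadius] using h2

theorem HolderDensity.lintegral_neg_log_nnMass [NeZero d] (hf : HolderDensity d s L f) (hs : 0 < s)
    (hk : 1 ≤ k) (hkm : k ≤ m) (x : Euc d) :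
    ∫⁻ Y, ENNReal.ofReal (-log (nnMass d k f (x, Y)))
      ∂(Measure.pi fun _ : Fin m => densityMeasure d f) =
      ENNReal.ofReal (∑ j ∈ Finset.Icc k m, (1 : ℝ) / j) := by
  have := hf.isProbabilityMeasure hs
  have := Measure.isProbabilityMeasure_map (measurable_torusDist_right x).aemeasurable
    (μ := densityMeasure d f)
  have := hf.nullSingletonClass_map x
  have h := lintegral_neg_log_cdf_orderStat ((densityMeasure d f).map (torusDist d x)) hk hkm
  have hmeas : Measurable fun D : Fin m → ℝ => ENNReal.ofReal (-log (ProbabilityTheory.cdf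
      ((densityMeasure d f).map (torusDist d x)) (orderStat k D))) :=
    (measurable_cdf_orderStat _ hk hkm).log.neg.ennreal_ofReal
  rw [← hf.map_pi hs, lintegral_map hmeas (measurable_torusDist_pi x)] at h
  simpa only [hf.cdf_map hs, nnMass, nnRadius] using h

theorem HolderDensity.lintegral_sq_nnMass [NeZero d] (hf : HolderDensity d s L f) (hs : 0 < s)
    (hk : 1 ≤ k) (hkm : k ≤ m) (x : Euc d) :
    ∫⁻ Y, ENNReal.ofReal (nnMass d k f (x, Y) ^ 2)
      ∂(Measure.pi fun _ : Fin m => densityMeasure d f) =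
      ENNReal.ofReal (k * (k + 1) / ((m + 1) * (m + 2))) := by
  have := hf.isProbabilityMeasure hs
  have := Measure.isProbabilityMeasure_map (measurable_torusDist_right x).aemeasurable
    (μ := densityMeasure d f)
  have := hf.nullSingletonClass_map x
  have h := lintegral_sq_cdf_orderStat ((densityMeasure d f).map (torusDist d x)) hk hkm
  rw [← hf.map_pi hs, lintegral_map
    ((measurable_cdf_orderStat _ hk hkm).pow_const 2).ennreal_ofReal
    (measurable_torusDist_pi x)] at h
  simpa only [hf.cdf_map hs, nnMass, nnRadius] using h

theorem HolderDensity.integrable_log_nnMass [NeZero d] (hf : HolderDensity d s L f) (hs : 0 < s)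
    (hk : 1 ≤ k) (hkm : k ≤ m) :
    Integrable (fun p => log (nnMass d k f p))
      ((densityMeasure d f).prod (Measure.pi fun _ : Fin m => densityMeasure d f)) ∧
    ∫ p, log (nnMass d k f p)
      ∂((densityMeasure d f).prod (Measure.pi fun _ : Fin m => densityMeasure d f)) =
      -∑ j ∈ Finset.Icc k m, (1 : ℝ) / j := by
  have := hf.isProbabilityMeasure hs
  have hmeas : Measurable fun p : Euc d × (Fin m → Euc d) => -log (nnMass d k f p) :=
    (measurable_log.comp (hf.measurable_nnMass hs hk hkm)).neg
  have hnn : ∀ p : Euc d × (Fin m → Euc d), 0 ≤ -log (nnMass d k f p) := fun p =>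
    neg_nonneg.2 (log_nonpos measureReal_nonneg (hf.nnMass_le_one hs p))
  have hl : ∫⁻ p, ENNReal.ofReal (-log (nnMass d k f p))
      ∂((densityMeasure d f).prod (Measure.pi fun _ : Fin m => densityMeasure d f)) =
      ENNReal.ofReal (∑ j ∈ Finset.Icc k m, (1 : ℝ) / j) := by
    rw [lintegral_prod _ hmeas.ennreal_ofReal.aemeasurable]
    simp_rw [hf.lintegral_neg_log_nnMass hs hk hkm]
    rw [lintegral_const, measure_univ, mul_one]
  have hint := (lintegral_ofReal_ne_top_iff_integrable hmeas.aestronglyMeasurable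
    (Filter.Eventually.of_forall hnn)).1 (hl ▸ ENNReal.ofReal_ne_top)
  refine ⟨by simpa using hint.neg, ?_⟩
  have h := integral_eq_lintegral_of_nonneg_ae (Filter.Eventually.of_forall hnn)
    hmeas.aestronglyMeasurable (μ := (densityMeasure d f).prod
      (Measure.pi fun _ : Fin m => densityMeasure d f))
  rw [hl, integral_neg, ENNReal.toReal_ofReal (Finset.sum_nonneg fun j _ => by positivity)] at h
  linarith

theorem volume_unitCube : volume (unitCube d) = 1 := by
  have h := setLIntegral_unitCube_eq (d := d) (g := fun _ => 1) (fun _ _ => rfl) 0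
  simpa [volume_centredCube] using h

theorem HolderDensity.ae_pos (hf : HolderDensity d s L f) (hs : 0 < s) :
    ∀ᵐ x ∂densityMeasure d f, 0 < f x := by
  rw [densityMeasure, ae_withDensity_iff (hf.continuous hs).measurable.ennreal_ofReal]
  refine Filter.Eventually.of_forall fun x hx => ?_
  simpa using hx

theorem HolderDensity.integrable_log (hf : HolderDensity d s L f) (hs : 0 < s) :
    Integrable (fun x => log (f x)) (densityMeasure d f) ∧
      ∫ x, log (f x) ∂densityMeasure d f = -diffEntropy d f := by
  have hm := (hf.continuous hs).measurable.ennreal_ofReal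
  have hlt : ∀ᵐ x ∂volume.restrict (unitCube d), ENNReal.ofReal (f x) < ⊤ :=
    Filter.Eventually.of_forall fun _ => ENNReal.ofReal_lt_top
  constructor
  · rw [densityMeasure, integrable_withDensity_iff_integrable_smul' hm hlt]
    simp_rw [ENNReal.toReal_ofReal (hf.2.2.1 _), smul_eq_mul]
    refine (continuous_mul_log.comp (hf.continuous hs)).integrableOn_of_norm_le (r := √d)
      fun w hw => norm_le_sqrt_of_abs_le_one fun i => abs_le.2 ⟨by linarith [(hw i).1], (hw i).2⟩
  · rw [densityMeasure, integral_withDensity_eq_integral_toReal_smul hm hlt, diffEntropy, neg_neg]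
    simp_rw [ENNReal.toReal_ofReal (hf.2.2.1 _), smul_eq_mul]

end

section
/-! ### Bias of the estimator -/

variable {d k m : ℕ} {s L : ℝ} {f : Euc d → ℝ}

theorem sum_Icc_one_div_le (hk : 1 ≤ k) (m : ℕ) :
    ∑ j ∈ Finset.Icc k m, (1 : ℝ) / j ≤ 1 + log m := by
  refine le_trans ?_ (harmonic_le_one_add_log m)
  rw [harmonic_eq_sum_Icc]
  push_cast
  simp_rw [one_div]
  exact Finset.sum_le_sum_of_subset_of_nonneg (Finset.Icc_subset_Icc_left hk)
    fun j _ _ => by positivity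

theorem nnMass_moments_le {A l : ℝ} (hk : 1 ≤ k) (hA : 0 ≤ A)
    (hl : 1 ≤ l) (hlm : log m ≤ l) :
    A * l + A * l * ((m + 1 : ℕ) : ℝ) ^ 2 * (k * (k + 1) / ((m + 1) * (m + 2))) +
      A * ∑ j ∈ Finset.Icc k m, (1 : ℝ) / j ≤ A * l * (3 + k * (k + 1)) := by
  have h1 : ((m + 1 : ℕ) : ℝ) ^ 2 * (k * (k + 1) / ((m + 1) * (m + 2))) ≤ k * (k + 1) := by
    push_cast
    rw [mul_div_assoc', div_le_iff₀ (by positivity)]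
    have : (0 : ℝ) ≤ k * (k + 1) * (m + 1) := by positivity
    nlinarith
  have h2 : ∑ j ∈ Finset.Icc k m, (1 : ℝ) / j ≤ 2 * l :=
    (sum_Icc_one_div_le hk m).trans (by linarith)
  have hAl : 0 ≤ A * l := by positivity
  calc _ = A * l + A * l * (((m + 1 : ℕ) : ℝ) ^ 2 * (k * (k + 1) / ((m + 1) * (m + 2)))) +
      A * ∑ j ∈ Finset.Icc k m, (1 : ℝ) / j := by ring
    _ ≤ A * l + A * l * (k * (k + 1)) + A * (2 * l) := by gcongr
    _ = _ := by ring

/-- The logarithm of the ratio between the density and its local estimate. -/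
noncomputable def logRatio (d k : ℕ) {m : ℕ} (f : Euc d → ℝ) (p : Euc d × (Fin m → Euc d)) : ℝ :=
  log (f p.1 / (nnMass d k f p / (unitBallVol d * nnRadius d k p ^ d)))

theorem HolderDensity.measurable_logRatio (hf : HolderDensity d s L f) (hs : 0 < s) (hk : 1 ≤ k)
    (hkm : k ≤ m) : Measurable fun p : Euc d × (Fin m → Euc d) => logRatio d k f p := by
  have h1 : Measurable fun p : Euc d × (Fin m → Euc d) => f p.1 :=
    (hf.continuous hs).measurable.comp measurable_fst
  exact (h1.div ((hf.measurable_nnMass hs hk hkm).div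
    (((measurable_nnRadius hk hkm).pow_const d).const_mul _))).log

/-- The local error integrates to the claimed rate, once weighted by the density. -/
theorem HolderDensity.lintegral_mul_logRatio_le [NeZero d] (hf : HolderDensity d s L f)
    (hs : 0 < s) (hk : 1 ≤ k) (hkm : k ≤ m) (x : Euc d) {A : ℝ} (hA : 0 ≤ A)
    (h : ∀ Y : Fin m → Euc d, 0 < nnMass d k f (x, Y) → f x * |logRatio d k f (x, Y)| ≤
      A * ((1 + (((m + 1 : ℕ) : ℝ) * nnMass d k f (x, Y)) ^ 2) * log ((m + 1 : ℕ) + 1) +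
        |log (nnMass d k f (x, Y))|)) :
    ENNReal.ofReal (f x) * ∫⁻ Y, ‖logRatio d k f (x, Y)‖ₑ
      ∂(Measure.pi fun _ : Fin m => densityMeasure d f) ≤
      ENNReal.ofReal (A * log ((m + 1 : ℕ) + 1) * (3 + k * (k + 1))) := by
  have := hf.isProbabilityMeasure hs
  set P := Measure.pi fun _ : Fin m => densityMeasure d f
  set l := log ((m + 1 : ℕ) + 1 : ℝ)
  have hl : 1 ≤ l := one_le_log_add_one (by omega)
  have hUm : Measurable fun Y : Fin m → Euc d => nnMass d k f (x, Y) :=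
    (hf.measurable_nnMass hs hk hkm).of_uncurry_left (f := fun x Y => nnMass d k f (x, Y))
  have hGm : Measurable fun Y : Fin m → Euc d => logRatio d k f (x, Y) :=
    (hf.measurable_logRatio hs hk hkm).of_uncurry_left (f := fun x Y => logRatio d k f (x, Y))
  have hlogm : Measurable fun Y : Fin m → Euc d =>
      ENNReal.ofReal (-log (nnMass d k f (x, Y))) := hUm.log.neg.ennreal_ofReal
  have hlm : log m ≤ l := by
    have : (0 : ℝ) < m := Nat.cast_pos.2 (by omega)
    refine log_le_log this ?_
    push_cast
    linarith
  set B := A * l * ((m + 1 : ℕ) : ℝ) ^ 2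
  have hB : 0 ≤ B := by positivity
  calc ENNReal.ofReal (f x) * ∫⁻ Y, ‖logRatio d k f (x, Y)‖ₑ ∂P
      = ∫⁻ Y, ENNReal.ofReal (f x) * ‖logRatio d k f (x, Y)‖ₑ ∂P :=
        (lintegral_const_mul _ hGm.enorm).symm
    _ ≤ ∫⁻ Y, (ENNReal.ofReal (A * l) + ENNReal.ofReal B *
          ENNReal.ofReal (nnMass d k f (x, Y) ^ 2) +
          ENNReal.ofReal A * ENNReal.ofReal (-log (nnMass d k f (x, Y)))) ∂P := by
        refine lintegral_mono_ae ?_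
        filter_upwards [hf.ae_nnMass_pos hs hk hkm x] with Y hY
        have hlog : log (nnMass d k f (x, Y)) ≤ 0 := log_nonpos hY.le (hf.nnMass_le_one hs _)
        rw [enorm_eq_ofReal_abs, ← ENNReal.ofReal_mul (hf.2.2.1 x), ← ENNReal.ofReal_mul hB,
          ← ENNReal.ofReal_mul hA, ← ENNReal.ofReal_add (by positivity) (by positivity),
          ← ENNReal.ofReal_add (by positivity) (mul_nonneg hA (by linarith))]
        refine ENNReal.ofReal_le_ofReal ((h Y hY).trans_eq ?_)
        rw [abs_of_nonpos hlog]
        simp only [B, l]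
        ring
    _ = ENNReal.ofReal (A * l) + ENNReal.ofReal B *
          ENNReal.ofReal (k * (k + 1) / ((m + 1) * (m + 2))) +
          ENNReal.ofReal A * ENNReal.ofReal (∑ j ∈ Finset.Icc k m, (1 : ℝ) / j) := by
        rw [lintegral_add_right _ (hlogm.const_mul _),
          lintegral_add_right _ ((hUm.pow_const 2).ennreal_ofReal.const_mul _),
          lintegral_const_mul _ (hUm.pow_const 2).ennreal_ofReal,
          lintegral_const_mul _ hlogm,
          lintegral_const, measure_univ, mul_one, hf.lintegral_sq_nnMass hs hk hkm,
          hf.lintegral_neg_log_nnMass hs hk hkm]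
    _ ≤ _ := by
        have hS : 0 ≤ ∑ j ∈ Finset.Icc k m, (1 : ℝ) / j :=
          Finset.sum_nonneg fun j _ => by positivity
        rw [← ENNReal.ofReal_mul hB, ← ENNReal.ofReal_mul hA,
          ← ENNReal.ofReal_add (by positivity) (by positivity),
          ← ENNReal.ofReal_add (by positivity) (by positivity)]
        exact ENNReal.ofReal_le_ofReal (nnMass_moments_le hk hA hl hlm)

theorem exists_mul_abs_logRatio_le [NeZero d] (hk : 1 ≤ k) (hs : 0 < s) (hs2 : s ≤ 2)
    (hL : 0 < L) : ∃ K : ℝ, 0 < K ∧ ∀ m : ℕ, k ≤ m → ∀ f : Euc d → ℝ, HolderDensity d s L f →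
      ∀ (x : Euc d) (Y : Fin m → Euc d), 0 < nnMass d k f (x, Y) →
        f x * |logRatio d k f (x, Y)| ≤ K * ((m + 1 : ℕ) : ℝ) ^ (-(s / (s + d))) *
          ((1 + (((m + 1 : ℕ) : ℝ) * nnMass d k f (x, Y)) ^ 2) * log ((m + 1 : ℕ) + 1) +
            |log (nnMass d k f (x, Y))|) := by
  obtain ⟨K, hK, hK'⟩ := exists_mul_abs_log_le (C := L + (1 + L * √d ^ s) * 2 ^ s)
    (NeZero.one_le (n := d)) hs hs2 (by positivity) (unitBallVol_pos (d := d)) √d (1 + L * √d ^ s)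
  refine ⟨K, hK, fun m hkm f hf x Y hY => ?_⟩
  have hR := hf.nnRadius_pos hs hL.le hk hkm hY
  have hRD := nnRadius_le_sqrt hk hkm (x, Y)
  have hU := hf.nnMass_le_one hs (k := k) (x, Y)
  unfold logRatio
  simp only [nnMass] at hY hU ⊢
  exact hK' (m + 1) (by omega) _ (f x) _ (hf.ballMass_mono hs x)
    (fun r hr => hf.abs_ballMass_sub_le hs hL.le x hr) (hf.2.2.1 x) (hf.le_one_add hs hL.le x)
    hR hRD hY hU (hf.ballMass_le hs hL.le x hR.le)

theorem HolderDensity.lintegral_prod_le (hf : HolderDensity d s L f) (hs : 0 < s)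
    {β : Type*} [MeasurableSpace β] (P : Measure β) [SFinite P] {G : Euc d × β → ENNReal}
    (hG : Measurable G) {c : ENNReal}
    (h : ∀ x, ENNReal.ofReal (f x) * ∫⁻ y, G (x, y) ∂P ≤ c) :
    ∫⁻ p, G p ∂((densityMeasure d f).prod P) ≤ c := by
  rw [lintegral_prod _ hG.aemeasurable, densityMeasure, lintegral_withDensity_eq_lintegral_mul _
    (hf.continuous hs).measurable.ennreal_ofReal hG.lintegral_prod_right']
  refine (lintegral_mono h).trans_eq ?_
  rw [setLIntegral_const, volume_unitCube, mul_one]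

theorem exists_integral_logRatio_le [NeZero d] (hk : 1 ≤ k) (hs : 0 < s) (hs2 : s ≤ 2)
    (hL : 0 < L) : ∃ K : ℝ, 0 < K ∧ ∀ m : ℕ, k ≤ m → ∀ f : Euc d → ℝ, HolderDensity d s L f →
      Integrable (fun p => logRatio d k f p)
        ((densityMeasure d f).prod (Measure.pi fun _ : Fin m => densityMeasure d f)) ∧
      |∫ p, logRatio d k f p
        ∂((densityMeasure d f).prod (Measure.pi fun _ : Fin m => densityMeasure d f))| ≤
        K * ((m + 1 : ℕ) : ℝ) ^ (-(s / (s + d))) * log ((m + 1 : ℕ) + 1) := by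
  obtain ⟨K, hK, hK'⟩ := exists_mul_abs_logRatio_le (d := d) hk hs hs2 hL
  refine ⟨K * (3 + k * (k + 1)), by positivity, fun m hkm f hf => ?_⟩
  have := hf.isProbabilityMeasure hs
  have hG : Measurable fun p : Euc d × (Fin m → Euc d) => logRatio d k f p :=
    hf.measurable_logRatio hs hk hkm
  have hGe : Measurable fun p : Euc d × (Fin m → Euc d) => ‖logRatio d k f p‖ₑ := hG.enorm
  have ha : 0 < ((m + 1 : ℕ) : ℝ) ^ (-(s / (s + d))) := rpow_pos_of_pos (by positivity) _
  have hl : 1 ≤ log ((m + 1 : ℕ) + 1 : ℝ) := one_le_log_add_one (by omega)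
  have hlin := hf.lintegral_prod_le hs (Measure.pi fun _ : Fin m => densityMeasure d f) hGe
    fun x => hf.lintegral_mul_logRatio_le hs hk hkm x (mul_pos hK ha).le (hK' m hkm f hf x)
  refine ⟨⟨hG.aestronglyMeasurable, hlin.trans_lt ENNReal.ofReal_lt_top⟩, ?_⟩
  rw [← Real.norm_eq_abs]
  refine (norm_integral_le_lintegral_norm _).trans ?_
  simp_rw [ofReal_norm]
  refine (ENNReal.toReal_le_of_le_ofReal (by positivity) hlin).trans_eq ?_
  ring

theorem HolderDensity.ae_log_eq [NeZero d] (hf : HolderDensity d s L f) (hs : 0 < s)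
    (hL : 0 ≤ L) (hk : 1 ≤ k) (hkm : k ≤ m) :
    ∀ᵐ p ∂((densityMeasure d f).prod (Measure.pi fun _ : Fin m => densityMeasure d f)),
      log (((m + 1 : ℕ) / k : ℝ) * (unitBallVol d * nnRadius d k p ^ d)) =
        log (m + 1 : ℕ) - log k + log (nnMass d k f p) + logRatio d k f p - log (f p.1) := by
  have := hf.isProbabilityMeasure hs
  have h1 : ∀ᵐ p ∂((densityMeasure d f).prod (Measure.pi fun _ : Fin m => densityMeasure d f)),
      0 < nnMass d k f p :=
    (Measure.ae_prod_iff_ae_ae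
      (measurableSet_lt measurable_const (hf.measurable_nnMass hs hk hkm))).2
      (Filter.Eventually.of_forall fun x => hf.ae_nnMass_pos hs hk hkm x)
  have h2 : ∀ᵐ p ∂((densityMeasure d f).prod (Measure.pi fun _ : Fin m => densityMeasure d f)),
      0 < f p.1 := Measure.quasiMeasurePreserving_fst.ae (hf.ae_pos hs)
  filter_upwards [h1, h2] with p hp hfp
  have hR := hf.nnRadius_pos hs hL hk hkm hp
  have hV := unitBallVol_pos (d := d)
  have hb : 0 < unitBallVol d * nnRadius d k p ^ d := by positivity
  have hk' : (k : ℝ) ≠ 0 := Nat.cast_ne_zero.2 (by omega)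
  have hm' : ((m + 1 : ℕ) : ℝ) ≠ 0 := Nat.cast_ne_zero.2 (by omega)
  rw [logRatio, log_mul (div_ne_zero hm' hk') hb.ne', log_div hm' hk',
    log_div hfp.ne' (by positivity),
    log_div hp.ne' hb.ne']
  ring

/-- The expected estimator decomposes into a digamma error and a local density error. -/
theorem HolderDensity.integral_klEstimator_sub [NeZero d] (hf : HolderDensity d s L f) (hs : 0 < s)
    (hL : 0 ≤ L) (hk : 1 ≤ k) (hkm : k ≤ m)
    (hint : Integrable (fun p => logRatio d k f p)
      ((densityMeasure d f).prod (Measure.pi fun _ : Fin m => densityMeasure d f))) :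
    (∫ X, klEstimator d k (m + 1) X ∂ sampleMeasure d (m + 1) f) - diffEntropy d f =
      (log (m + 1 : ℕ) - digamma (m + 1 : ℕ)) + ∫ p, logRatio d k f p
        ∂((densityMeasure d f).prod (Measure.pi fun _ : Fin m => densityMeasure d f)) := by
  have := hf.isProbabilityMeasure hs
  obtain ⟨hU, hU'⟩ := hf.integrable_log_nnMass hs hk hkm
  obtain ⟨hlf, hlf'⟩ := hf.integrable_log hs
  have hae := hf.ae_log_eq hs hL hk hkm
  set μ := densityMeasure d f
  set P := Measure.pi fun _ : Fin m => μ
  set g : Euc d × (Fin m → Euc d) → ℝ := fun p =>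
    log (((m + 1 : ℕ) / k : ℝ) * (unitBallVol d * nnRadius d k p ^ d))
  have hlf1 : Integrable (fun p : Euc d × (Fin m → Euc d) => log (f p.1)) (μ.prod P) :=
    hlf.comp_fst P
  have hlf2 : ∫ p, log (f p.1) ∂(μ.prod P) = -diffEntropy d f := by
    rw [← hlf', integral_fun_fst (fun x => log (f x))]
    simp
  have hc : Integrable (fun _ : Euc d × (Fin m → Euc d) => log (m + 1 : ℕ) - log k) (μ.prod P) :=
    integrable_const _
  have h1 : Integrable (fun p => log (m + 1 : ℕ) - log k + log (nnMass d k f p)) (μ.prod P) :=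
    hc.add hU
  have h2 : Integrable (fun p => log (m + 1 : ℕ) - log k + log (nnMass d k f p) +
      logRatio d k f p) (μ.prod P) := h1.add hint
  have hgint : Integrable g (μ.prod P) := (h2.sub hlf1).congr (hae.mono fun p hp => hp.symm)
  have hg : ∫ p, g p ∂(μ.prod P) = log (m + 1 : ℕ) - log k - ∑ j ∈ Finset.Icc k m, (1 : ℝ) / j +
      ∫ p, logRatio d k f p ∂(μ.prod P) + diffEntropy d f := by
    rw [integral_congr_ae hae, integral_sub h2 hlf1, integral_add h1 hint, integral_add hc hU, hU',
      hlf2, integral_const]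
    simp
    ring
  have hmp := fun i : Fin (m + 1) =>
    measurePreserving_piFinSuccAbove (fun _ : Fin (m + 1) => μ) i
  have hi : ∀ i : Fin (m + 1), Integrable (fun X : Fin (m + 1) → Euc d =>
      log (((m + 1 : ℕ) / k : ℝ) * (unitBallVol d * nnDist d (m + 1) X i k ^ d)))
      (sampleMeasure d (m + 1) f) ∧
      ∫ X, log (((m + 1 : ℕ) / k : ℝ) * (unitBallVol d * nnDist d (m + 1) X i k ^ d))
        ∂(sampleMeasure d (m + 1) f) = ∫ p, g p ∂(μ.prod P) := by
    intro i
    simp_rw [nnDist_eq_nnRadius]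
    exact ⟨((hmp i).integrable_comp_emb (MeasurableEquiv.measurableEmbedding _)).2 hgint,
      (hmp i).integral_comp (MeasurableEquiv.measurableEmbedding _) g⟩
  have hprob : IsProbabilityMeasure (sampleMeasure d (m + 1) f) :=
    inferInstanceAs (IsProbabilityMeasure (Measure.pi fun _ : Fin (m + 1) => μ))
  simp only [klEstimator]
  rw [integral_add (integrable_const _)
    ((integrable_finsetSum _ fun i _ => (hi i).1).const_mul _), integral_const,
    integral_const_mul, integral_finsetSum _ fun i _ => (hi i).1,
    Finset.sum_congr rfl fun i _ => (hi i).2, hg]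
  have hdig := digamma_add_sum_eq hk hkm
  have hm' : ((m + 1 : ℕ) : ℝ) ≠ 0 := Nat.cast_ne_zero.2 (by omega)
  simp only [Finset.sum_const, Finset.card_univ, Fintype.card_fin, nsmul_eq_mul, one_div,
    probReal_univ, one_smul]
  rw [inv_mul_cancel_left₀ hm']
  push_cast at hdig ⊢
  simp only [one_div] at hdig
  linarith

end

noncomputable section

/-- Bias bound for the fixed-`k` Kozachenko–Leonenko estimator
over the Hölder ball. -/
theorem kl_estimator_bias_upper_bound (d k : ℕ) (hd : 1 ≤ d) (hk : 1 ≤ k)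
    (s L : ℝ) (hs : 0 < s) (hs2 : s ≤ 2) (hL : 0 < L) :
    ∃ C : ℝ, 0 < C ∧ ∀ n : ℕ, k < n → ∀ f : Euc d → ℝ, HolderDensity d s L f →
      |(∫ X, klEstimator d k n X ∂ sampleMeasure d n f) - diffEntropy d f|
        ≤ C * (n : ℝ) ^ (-(s / (s + d))) * Real.log (n + 1) := by
  have : NeZero d := ⟨by omega⟩
  obtain ⟨K, hK, hK'⟩ := exists_integral_logRatio_le (d := d) hk hs hs2 hL
  refine ⟨1 + K, by positivity, fun n hn f hf => ?_⟩
  obtain ⟨m, rfl⟩ : ∃ m, n = m + 1 := ⟨n - 1, by omega⟩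
  obtain ⟨hint, hle⟩ := hK' m (by omega) f hf
  rw [hf.integral_klEstimator_sub hs hL.le hk (by omega) hint]
  set a := ((m + 1 : ℕ) : ℝ) ^ (-(s / (s + d)))
  set l := Real.log ((m + 1 : ℕ) + 1 : ℝ)
  have ha : 0 < a := rpow_pos_of_pos (by positivity) _
  have hl : 1 ≤ l := one_le_log_add_one (by omega)
  have h1 : (1 : ℝ) / (m + 1 : ℕ) ≤ a := by
    rw [one_div, ← rpow_neg_one]
    refine rpow_le_rpow_of_exponent_le (by push_cast; linarith [Nat.cast_nonneg (α := ℝ) m])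
      (neg_le_neg ?_)
    rw [div_le_one (by positivity)]
    linarith [Nat.cast_nonneg (α := ℝ) d]
  have h2 := (abs_log_sub_digamma_le (n := m + 1) (by omega)).trans h1
  calc _ ≤ _ := abs_add_le _ _
    _ ≤ a * l + K * a * l := add_le_add (h2.trans (le_mul_of_one_le_right ha.le hl)) hle
    _ = _ := by ring

end
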